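/- arXiv:1803.09527 — 10 statements merged into one kernel-verified Lean document; each statement's English description precedes it below -/
import Mathlib

section
/- Under the stated relation between Q₂ and Q₁ through the involution φ, the Markov kernel P̊(x, dy) := ∫_U Q₁(x, d(y,u)) min{1, r_{1,u}(x,y)} + ρ₁(x) δ_x(dy) satisfies detailed balance with respect to π: for every bounded measurable φ : X × X → ℝ, ∫∫ φ(x,y) π(dx) P̊(x,dy) = ∫∫ φ(y,x) π(dx) P̊(x,dy). -/
open MeasureTheory ProbabilityTheory

namespace PseudoMarginalRatio

variable {X U : Type*} [MeasurableSpace X] [MeasurableSpace U]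

theorem bind_map_prodMk_eq_compProd (π : Measure X) [SFinite π]
    (Q : Kernel X (X × U)) [IsSFiniteKernel Q] :
    π.bind (fun x => (Q x).map (fun yu => (x, yu))) = π ⊗ₘ Q := by
  rw [Measure.compProd_eq_comp_prod]
  congr 1
  funext x
  rw [Kernel.prod_apply, Kernel.id_apply, Measure.dirac_prod]

/-- Exchange of the first two coordinates. -/
def swapFirst (p : X × X × U) : X × X × U := (p.2.1, p.1, p.2.2)

theorem measurable_swapFirst : Measurable (swapFirst : X × X × U → X × X × U) := by
  unfold swapFirst
  fun_prop

theorem bind_map_swap_eq_map_compProd (π : Measure X) [SFinite π]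
    (Q : Kernel X (X × U)) [IsSFiniteKernel Q] :
    π.bind (fun y => (Q y).map (fun xu => (xu.1, y, xu.2))) = (π ⊗ₘ Q).map swapFirst := by
  rw [Measure.compProd_eq_comp_prod, Measure.map_comp _ _ measurable_swapFirst]
  congr 1
  funext x
  rw [Kernel.map_apply _ measurable_swapFirst, Kernel.prod_apply, Kernel.id_apply,
    Measure.dirac_prod, Measure.map_map measurable_swapFirst (by fun_prop)]
  rfl

theorem map_withDensity_of_involutive {α : Type*} [MeasurableSpace α] (ν : Measure α)
    {f : α → ENNReal} (hf : Measurable f) {t : α → α} (ht : Measurable t)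
    (htt : Function.Involutive t) :
    (ν.withDensity f).map t = (ν.map t).withDensity (f ∘ t) := by
  ext s hs
  rw [Measure.map_apply ht hs, withDensity_apply _ (ht hs), withDensity_apply _ hs,
    setLIntegral_map hs (hf.comp ht) ht]
  simp [htt _]

theorem measure_ext_of_integral_bounded {α : Type*} [MeasurableSpace α] {μ ν : Measure α}
    [IsFiniteMeasure μ] [IsFiniteMeasure ν]
    (h : ∀ ψ : α → ℝ, Measurable ψ → (∃ C, ∀ p, |ψ p| ≤ C) → ∫ p, ψ p ∂μ = ∫ p, ψ p ∂ν) :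
    μ = ν := by
  ext s hs
  have := h (s.indicator 1) (measurable_one.indicator hs) ⟨1, fun p => by
    by_cases hp : p ∈ s <;> simp [hp]⟩
  rw [integral_indicator_one hs, integral_indicator_one hs] at this
  exact (measureReal_eq_measureReal_iff).1 this

theorem integrable_integral_of_integrable_compProd {α β : Type*} [MeasurableSpace α]
    [MeasurableSpace β] {μ : Measure α} [SFinite μ] {κ : Kernel α β} [IsSFiniteKernel κ]
    {f : α × β → ℝ} (hf : Integrable f (μ ⊗ₘ κ)) :
    Integrable (fun x => ∫ y, f (x, y) ∂(κ x)) μ := by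
  rw [Measure.compProd] at hf
  exact hf.integral_compProd

/-- If `t` is an involution preserving `ν`, integrals against `min f (f ∘ t) • ν` are invariant
under `t`. -/
theorem integral_min_comp_involutive {α : Type*} [MeasurableSpace α] {ν : Measure α}
    {f : α → ℝ} {t : α → α} (ht : Measurable t) (htt : Function.Involutive t)
    (hν : ν.map t = ν) (g : α → ℝ) :
    ∫ p, min (f p) (f (t p)) * g p ∂ν = ∫ p, min (f p) (f (t p)) * g (t p) ∂ν := by
  have h := MeasurePreserving.integral_comp' (f := (⟨htt.toPerm, ht, ht⟩ : α ≃ᵐ α))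
    (μ := ν) (ν := ν) ⟨ht, hν⟩ (fun p => min (f p) (f (t p)) * g p)
  rw [← h]
  refine integral_congr_ae (.of_forall fun p => ?_)
  change min (f (t p)) (f (t (t p))) * g (t p) = _
  rw [htt p, min_comm]

end PseudoMarginalRatio



/-- **Detailed balance of pseudo-marginal-ratio Metropolis–Hastings (Theorem
`thm: pseudo-marginal ratio algorithms` of Andrieu, Doucet, Yıldırım & Chopin).**

Let `e : U → U` be a measurable involution and suppose `Q₂` is related to `Q₁` by
`∫ ψ(x,y,u) d(π ⊗ Q₂) = ∫ ψ(x,y,e(u)) d(π ⊗ Q₁)` for all bounded measurable `ψ`.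
With `η₁, η₂` versions of the Radon–Nikodym derivatives of `π ⊗ Q₁, π ⊗ Q₂` w.r.t.
`ν₁, ν₂`, `r_{1,u}(x,y) = η₂(y,x,u)/η₁(x,y,u)` on `S` (else `0`), and `ρ₁` the rejection
probability, the kernel `P̊(x,dy) = ∫_U Q₁(x,d(y,u)) min{1, r_{1,u}(x,y)} + ρ₁(x)δ_x(dy)`
satisfies detailed balance with respect to `π`. -/
theorem pmr_detailed_balance
    {X U : Type*} [MeasurableSpace X] [MeasurableSpace U]
    (π : Measure X) [IsProbabilityMeasure π]
    (Q₁ Q₂ : Kernel X (X × U)) [IsMarkovKernel Q₁] [IsMarkovKernel Q₂]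
    (e : U → U) (hem : Measurable e) (hee : ∀ u, e (e u) = u)
    -- relation between `π ⊗ Q₂` and `π ⊗ Q₁` through the involution `e`
    (hinv : ∀ ψ : X × X × U → ℝ, Measurable ψ → (∃ C, ∀ p, |ψ p| ≤ C) →
      ∫ p, ψ p ∂(π.bind (fun x => (Q₂ x).map (fun yu => (x, yu))))
        = ∫ p, ψ (p.1, p.2.1, e p.2.2)
            ∂(π.bind (fun x => (Q₁ x).map (fun yu => (x, yu)))))
    (η₁ η₂ : X × X × U → ℝ)
    (hη₁m : Measurable η₁) (hη₂m : Measurable η₂)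
    (hη₁0 : ∀ p, 0 ≤ η₁ p) (hη₂0 : ∀ p, 0 ≤ η₂ p)
    (hη₁ : π.bind (fun x => (Q₁ x).map (fun yu => (x, yu)))
      = (π.bind (fun x => (Q₁ x).map (fun yu => (x, yu)))
          + π.bind (fun y => (Q₂ y).map (fun xu => (xu.1, y, xu.2)))).withDensity
            (fun p => ENNReal.ofReal (η₁ p)))
    (hη₂ : π.bind (fun x => (Q₂ x).map (fun yu => (x, yu)))
      = (π.bind (fun x => (Q₂ x).map (fun yu => (x, yu)))
          + π.bind (fun y => (Q₁ y).map (fun xu => (xu.1, y, xu.2)))).withDensity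
            (fun p => ENNReal.ofReal (η₂ p)))
    (r₁ : X × X × U → ℝ)
    (hr₁ : ∀ p : X × X × U, r₁ p =
      if 0 < η₁ p ∧ 0 < η₂ (p.2.1, p.1, p.2.2)
        then η₂ (p.2.1, p.1, p.2.2) / η₁ p else 0)
    (ρ₁ : X → ℝ)
    (hρ₁ : ∀ x, ρ₁ x = 1 - ∫ yu, min 1 (r₁ (x, yu)) ∂(Q₁ x))
    (φ : X → X → ℝ) (hφ : Measurable (Function.uncurry φ))
    (hφb : ∃ C, ∀ x y, |φ x y| ≤ C) :
    ∫ x, ((∫ yu, min 1 (r₁ (x, yu)) * φ x yu.1 ∂(Q₁ x)) + ρ₁ x * φ x x) ∂π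
  = ∫ x, ((∫ yu, min 1 (r₁ (x, yu)) * φ yu.1 x ∂(Q₁ x)) + ρ₁ x * φ x x) ∂π := by
  let σ : X × X × U → X × X × U := PseudoMarginalRatio.swapFirst
  let E : X × X × U → X × X × U := fun p => (p.1, p.2.1, e p.2.2)
  have hσ : Measurable σ := PseudoMarginalRatio.measurable_swapFirst
  have hE : Measurable E := by fun_prop
  have hσσ : Function.Involutive σ := fun p => rfl
  have hEE : Function.Involutive E := fun p => by simp [E, hee]
  let t := σ ∘ E
  have ht : Measurable t := hσ.comp hE
  have htt : Function.Involutive t := fun p => by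
    change σ (E (σ (E p))) = p
    rw [show σ (E p) = E (σ p) from rfl, hEE, hσσ]
  simp only [PseudoMarginalRatio.bind_map_prodMk_eq_compProd,
    PseudoMarginalRatio.bind_map_swap_eq_map_compProd] at hinv hη₁ hη₂
  change _ = (_ + (π ⊗ₘ Q₂).map σ).withDensity _ at hη₁
  change _ = (_ + (π ⊗ₘ Q₁).map σ).withDensity _ at hη₂
  have hmap : π ⊗ₘ Q₂ = (π ⊗ₘ Q₁).map E := by
    have : IsProbabilityMeasure ((π ⊗ₘ Q₁).map E) :=
      Measure.isProbabilityMeasure_map hE.aemeasurable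
    refine PseudoMarginalRatio.measure_ext_of_integral_bounded fun ψ hψ hb => ?_
    rw [hinv ψ hψ hb, integral_map hE.aemeasurable hψ.aestronglyMeasurable]
  have hswap : (π ⊗ₘ Q₂).map σ = (π ⊗ₘ Q₁).map t := by
    rw [hmap, Measure.map_map hσ hE]
  set μ := π ⊗ₘ Q₁ with hμ
  have hmm : (μ.map t).map t = μ := by
    rw [Measure.map_map ht ht, htt.comp_self, Measure.map_id]
  rw [hswap] at hη₁
  set ν := μ + μ.map t with hνdef
  have hν : ν.map t = ν := by
    rw [hνdef, Measure.map_add _ _ ht, hmm, add_comm]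
  have hνσ : (π ⊗ₘ Q₂ + μ.map σ).map σ = ν := by
    rw [Measure.map_add _ _ hσ, hswap, Measure.map_map hσ hσ, hσσ.comp_self, Measure.map_id,
      add_comm]
  have hf₁ : Measurable fun p => ENNReal.ofReal (η₁ p) := hη₁m.ennreal_ofReal
  have hf₂ : Measurable fun p => ENNReal.ofReal (η₂ p) := hη₂m.ennreal_ofReal
  have hd₁ : μ.map t = ν.withDensity ((fun p => ENNReal.ofReal (η₁ p)) ∘ t) := by
    rw [hη₁, PseudoMarginalRatio.map_withDensity_of_involutive _ hf₁ ht htt, hν]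
  have hd₂ : μ.map t = ν.withDensity ((fun p => ENNReal.ofReal (η₂ p)) ∘ σ) := by
    rw [← hswap, hη₂, PseudoMarginalRatio.map_withDensity_of_involutive _ hf₂ hσ hσσ, hνσ]
  have hae : ∀ᵐ p ∂ν, η₁ (t p) = η₂ (σ p) := by
    have := (withDensity_eq_iff_of_sigmaFinite (hf₁.comp ht).aemeasurable
      (hf₂.comp hσ).aemeasurable).1 (hd₁.symm.trans hd₂)
    filter_upwards [this] with p hp
    exact (ENNReal.ofReal_eq_ofReal_iff (hη₁0 _) (hη₂0 _)).1 hp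
  have hrm : Measurable r₁ := by
    rw [funext hr₁]
    have h₂ : Measurable fun p : X × X × U => η₂ (p.2.1, p.1, p.2.2) := hη₂m.comp hσ
    exact Measurable.ite ((measurableSet_lt measurable_const hη₁m).inter
      (measurableSet_lt measurable_const h₂)) (h₂.div hη₁m) measurable_const
  have hr0 : ∀ p, 0 ≤ r₁ p := fun p => by
    rw [hr₁]
    split_ifs
    · exact div_nonneg (hη₂0 _) (hη₁0 _)
    · exact le_rfl
  have ham : Measurable fun p => min 1 (r₁ p) := measurable_const.min hrm
  have hab : ∀ p, |min 1 (r₁ p)| ≤ 1 := fun p => by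
    rw [abs_of_nonneg (le_min zero_le_one (hr0 p))]
    exact min_le_left _ _
  have hmin : ∀ p, η₁ p * min 1 (r₁ p) = min (η₁ p) (η₂ (σ p)) := fun p => by
    change _ = min (η₁ p) (η₂ (p.2.1, p.1, p.2.2))
    rw [hr₁]
    split_ifs with h
    · rw [mul_min_of_nonneg _ _ (hη₁0 p), mul_one, mul_div_cancel₀ _ h.1.ne']
    · rw [min_eq_right zero_le_one, mul_zero]
      rcases not_and_or.1 h with h | h
      · rw [le_antisymm (not_lt.1 h) (hη₁0 p), min_eq_left (hη₂0 _)]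
      · rw [le_antisymm (not_lt.1 h) (hη₂0 _), min_eq_right (hη₁0 p)]
  obtain ⟨C, hC⟩ := hφb
  have hint : ∀ g : X × X × U → ℝ, Measurable g → (∀ p, |g p| ≤ C) →
      Integrable (fun p => min 1 (r₁ p) * g p) μ := fun g hg hgC =>
    Integrable.of_bound (ham.mul hg).aestronglyMeasurable (1 * C) (.of_forall fun p => by
      rw [Real.norm_eq_abs, abs_mul]
      exact mul_le_mul (hab p) (hgC p) (abs_nonneg _) zero_le_one)
  have hdens : ∀ g : X × X × U → ℝ,
      ∫ p, min 1 (r₁ p) * g p ∂μ = ∫ p, min (η₁ p) (η₁ (t p)) * g p ∂ν := fun g => by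
    rw [hη₁, integral_withDensity_eq_integral_toReal_smul hf₁
      (.of_forall fun _ => ENNReal.ofReal_lt_top)]
    refine integral_congr_ae ?_
    filter_upwards [hae] with p hp
    rw [ENNReal.toReal_ofReal (hη₁0 p), smul_eq_mul, ← mul_assoc, hmin, hp]
  have hφ₁ : Measurable fun p : X × X × U => φ p.1 p.2.1 :=
    hφ.comp (measurable_fst.prodMk measurable_snd.fst)
  have hφ₂ : Measurable fun p : X × X × U => φ p.2.1 p.1 :=
    hφ.comp (measurable_snd.fst.prodMk measurable_fst)
  have hi₁ := hint _ hφ₁ fun _ => hC _ _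
  have hi₂ := hint _ hφ₂ fun _ => hC _ _
  have hρi : Integrable (fun x => ρ₁ x * φ x x) π := by
    have hone : Integrable (fun p => min 1 (r₁ p)) μ :=
      Integrable.of_bound ham.aestronglyMeasurable 1 (.of_forall hab)
    have hρ : Integrable ρ₁ π := by
      rw [funext hρ₁]
      exact (integrable_const _).sub
        (PseudoMarginalRatio.integrable_integral_of_integrable_compProd hone)
    exact hρ.mul_bdd (c := C) (hφ.comp (measurable_id.prodMk measurable_id)).aestronglyMeasurable
      (.of_forall fun x => hC x x)
  rw [integral_add
      (PseudoMarginalRatio.integrable_integral_of_integrable_compProd hi₁) hρi,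
    integral_add (PseudoMarginalRatio.integrable_integral_of_integrable_compProd hi₂) hρi,
    ← Measure.integral_compProd hi₁, ← Measure.integral_compProd hi₂, ← hμ, hdens, hdens,
    PseudoMarginalRatio.integral_min_comp_involutive ht htt hν]
  rfl
end

section
/- The measure ν₁ is invariant under the map (x,y,u) ↦ (y,x,φ(u)): for every bounded measurable ψ : X × X × U → ℝ, ∫ ψ(x,y,u) ν₁(d(x,y,u)) = ∫ ψ(x,y,φ(u)) ν₁(d(y,x,u)), i.e. the pushforward of ν₁ under (x,y,u) ↦ (y,x,φ(u)) equals ν₁. -/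
open MeasureTheory ProbabilityTheory

/-- A composition-product written as a `Measure.bind`. -/
lemma bind_map_prodMk_eq_compProd {X Y : Type*} [MeasurableSpace X] [MeasurableSpace Y]
    (π : Measure X) [SFinite π] (Q : Kernel X Y) [IsSFiniteKernel Q] :
    π.bind (fun x => (Q x).map (fun y => (x, y))) = π ⊗ₘ Q := by
  rw [Measure.compProd_eq_comp_prod]
  congr 1
  ext1 x
  rw [Kernel.prod_apply, Kernel.id_apply, Measure.dirac_prod]

lemma bind_map_eq_map_compProd {X Y Z : Type*} [MeasurableSpace X] [MeasurableSpace Y]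
    [MeasurableSpace Z] (π : Measure X) [SFinite π] (Q : Kernel X Y) [IsSFiniteKernel Q]
    {f : X × Y → Z} (hf : Measurable f) :
    π.bind (fun x => (Q x).map (fun y => f (x, y))) = (π ⊗ₘ Q).map f := by
  rw [Measure.compProd_eq_comp_prod, Measure.map_comp _ _ hf]
  congr 1
  ext1 x
  rw [Kernel.map_apply _ hf, Kernel.prod_apply, Kernel.id_apply, Measure.dirac_prod,
    Measure.map_map hf measurable_prodMk_left]
  rfl

lemma eq_map_of_forall_integral_eq {α β : Type*} [MeasurableSpace α] [MeasurableSpace β]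
    {μ : Measure α} {ν : Measure β} [IsFiniteMeasure μ] [IsFiniteMeasure ν]
    {f : α → β} (hf : Measurable f)
    (h : ∀ ψ : β → ℝ, Measurable ψ → (∃ C, ∀ p, |ψ p| ≤ C) →
      ∫ p, ψ p ∂ν = ∫ p, ψ (f p) ∂μ) :
    ν = μ.map f := by
  ext s hs
  have hψ : Measurable (s.indicator (1 : β → ℝ)) := measurable_one.indicator hs
  have key := h _ hψ ⟨1, fun p => by by_cases hp : p ∈ s <;> simp [hp]⟩
  rw [← integral_map hf.aemeasurable hψ.aestronglyMeasurable, integral_indicator_one hs,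
    integral_indicator_one hs] at key
  exact (measureReal_eq_measureReal_iff).1 key

/-- The sum of a measure and its pushforward under an involution is invariant. -/
lemma map_add_map_of_involutive {α : Type*} [MeasurableSpace α] (μ : Measure α) {T : α → α}
    (hT : Measurable T) (hTT : Function.Involutive T) :
    (μ + μ.map T).map T = μ + μ.map T := by
  rw [Measure.map_add _ _ hT, Measure.map_map hT hT, hTT.comp_self, Measure.map_id, add_comm]

/-- **Invariance of `ν₁` under `(x,y,u) ↦ (y,x,φ(u))` (Andrieu–Doucet–Yıldırım–Chopin).**

Let `ν₁(d(x,y,u)) = π(dx)Q₁(x,d(y,u)) + π(dy)Q₂(y,d(x,u))`, let `e : U → U` be a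
measurable involution, and assume `∫ ψ(x,y,u) d(π ⊗ Q₂) = ∫ ψ(x,y,e(u)) d(π ⊗ Q₁)` for every
bounded measurable `ψ`.  Then for every bounded measurable `ψ`,
`∫ ψ(x,y,u) ν₁(d(x,y,u)) = ∫ ψ(x,y,e(u)) ν₁(d(y,x,u))`; i.e. the pushforward of `ν₁`
under `(x,y,u) ↦ (y,x,e(u))` equals `ν₁`. -/
theorem nu_one_invariance
    {X U : Type*} [MeasurableSpace X] [MeasurableSpace U]
    (π : Measure X) [IsProbabilityMeasure π]
    (Q₁ Q₂ : Kernel X (X × U)) [IsMarkovKernel Q₁] [IsMarkovKernel Q₂]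
    (e : U → U) (hem : Measurable e) (hee : ∀ u, e (e u) = u)
    (hinv : ∀ ψ : X × X × U → ℝ, Measurable ψ → (∃ C, ∀ p, |ψ p| ≤ C) →
      ∫ p, ψ p ∂(π.bind (fun x => (Q₂ x).map (fun yu => (x, yu))))
        = ∫ p, ψ (p.1, p.2.1, e p.2.2)
            ∂(π.bind (fun x => (Q₁ x).map (fun yu => (x, yu)))))
    (ν₁ : Measure (X × X × U))
    (hν₁ : ν₁ = π.bind (fun x => (Q₁ x).map (fun yu => (x, yu)))
        + π.bind (fun y => (Q₂ y).map (fun xu => (xu.1, y, xu.2)))) :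
    (∀ ψ : X × X × U → ℝ, Measurable ψ → (∃ C, ∀ p, |ψ p| ≤ C) →
        ∫ p, ψ p ∂ν₁ = ∫ p, ψ (p.2.1, p.1, e p.2.2) ∂ν₁)
      ∧ ν₁.map (fun p : X × X × U => (p.2.1, p.1, e p.2.2)) = ν₁ := by
  have hE : Measurable fun p : X × X × U => (p.1, p.2.1, e p.2.2) := by fun_prop
  have hS : Measurable fun p : X × X × U => (p.2.1, p.1, p.2.2) := by fun_prop
  have hT : Measurable fun p : X × X × U => (p.2.1, p.1, e p.2.2) := by fun_prop
  have hTT : Function.Involutive fun p : X × X × U => (p.2.1, p.1, e p.2.2) :=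
    fun p => by simp [hee]
  simp only [bind_map_prodMk_eq_compProd] at hinv hν₁
  have hQ₂ : π ⊗ₘ Q₂ = (π ⊗ₘ Q₁).map fun p => (p.1, p.2.1, e p.2.2) :=
    eq_map_of_forall_integral_eq hE hinv
  rw [bind_map_eq_map_compProd π Q₂ hS, hQ₂, Measure.map_map hS hE] at hν₁
  have hmap : ν₁.map (fun p : X × X × U => (p.2.1, p.1, e p.2.2)) = ν₁ := by
    rw [hν₁]
    exact map_add_map_of_involutive _ hT hTT
  refine ⟨fun ψ hψ _ => ?_, hmap⟩
  conv_lhs => rw [← hmap]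
  exact integral_map hT.aemeasurable hψ.aestronglyMeasurable
end

section
/- The function (x,y,u) ↦ η₁(x,y,φ(u)) is a version of the Radon–Nikodym derivative of π ⊗ Q₂ with respect to ν₂; that is, η₂(x,y,u) = η₁(x,y,φ(u)) for ν₂-almost every (x,y,u). -/
open MeasureTheory ProbabilityTheory

theorem MeasureTheory.Measure.map_bind_of_measurable {α β γ : Type*} [MeasurableSpace α]
    [MeasurableSpace β] [MeasurableSpace γ] (m : Measure α) {κ : α → Measure β}
    (hκ : Measurable κ) {f : β → γ} (hf : Measurable f) :
    (m.bind κ).map f = m.bind (fun a => (κ a).map f) := by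
  unfold Measure.bind
  rw [← Measure.join_map_map hf, Measure.map_map (Measure.measurable_map f hf) hκ]
  rfl

theorem ProbabilityTheory.Kernel.measurable_map_prodMk {α β : Type*} [MeasurableSpace α]
    [MeasurableSpace β] (κ : Kernel α β) [IsSFiniteKernel κ] :
    Measurable (fun a => (κ a).map (fun b => (a, b))) := by
  convert (Kernel.id ×ₖ κ).measurable using 2 with a
  rw [Kernel.prod_apply, Kernel.id_apply, Measure.dirac_prod]

theorem MeasureTheory.Measure.map_withDensity_of_comp {α β : Type*} [MeasurableSpace α]
    [MeasurableSpace β] (μ : Measure α) {F : α → β} (hF : Measurable F) {g : β → ENNReal}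
    (hg : Measurable g) :
    (μ.withDensity (fun a => g (F a))).map F = (μ.map F).withDensity g := by
  ext s hs
  rw [Measure.map_apply hF hs, withDensity_apply _ (hF hs), withDensity_apply _ hs,
    setLIntegral_map hs hg hF]

theorem MeasureTheory.Measure.ext_of_forall_integral_bounded {α : Type*} [MeasurableSpace α]
    {μ ν : Measure α} [IsFiniteMeasure μ] [IsFiniteMeasure ν]
    (h : ∀ ψ : α → ℝ, Measurable ψ → (∃ C, ∀ p, |ψ p| ≤ C) → ∫ p, ψ p ∂μ = ∫ p, ψ p ∂ν) :
    μ = ν := by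
  ext s hs
  have hind := h (s.indicator 1) (measurable_one.indicator hs) ⟨1, fun p => by
    by_cases hp : p ∈ s <;> simp [hp]⟩
  rw [integral_indicator_one hs, integral_indicator_one hs] at hind
  exact (measureReal_eq_measureReal_iff).1 hind

/-- **`η₂(x,y,u) = η₁(x,y,φ(u))` `ν₂`-a.e. (Andrieu–Doucet–Yıldırım–Chopin).**

With `νᵢ(d(x,y,u)) = π(dx)Qᵢ(x,d(y,u)) + π(dy)Q_{3-i}(y,d(x,u))`, `ηᵢ` a measurable
version of `d(π ⊗ Qᵢ)/dνᵢ`, `e : U → U` a measurable involution, and the relation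
`∫ ψ(x,y,u) d(π ⊗ Q₂) = ∫ ψ(x,y,e(u)) d(π ⊗ Q₁)` for all bounded measurable `ψ`,
the function `(x,y,u) ↦ η₁(x,y,e(u))` is a version of `d(π ⊗ Q₂)/dν₂`; that is,
`η₂(x,y,u) = η₁(x,y,e(u))` for `ν₂`-almost every `(x,y,u)`. -/
theorem eta_two_eq_eta_one_comp_involution
    {X U : Type*} [MeasurableSpace X] [MeasurableSpace U]
    (π : Measure X) [IsProbabilityMeasure π]
    (Q₁ Q₂ : Kernel X (X × U)) [IsMarkovKernel Q₁] [IsMarkovKernel Q₂]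
    (e : U → U) (hem : Measurable e) (hee : ∀ u, e (e u) = u)
    (hinv : ∀ ψ : X × X × U → ℝ, Measurable ψ → (∃ C, ∀ p, |ψ p| ≤ C) →
      ∫ p, ψ p ∂(π.bind (fun x => (Q₂ x).map (fun yu => (x, yu))))
        = ∫ p, ψ (p.1, p.2.1, e p.2.2)
            ∂(π.bind (fun x => (Q₁ x).map (fun yu => (x, yu)))))
    (η₁ η₂ : X × X × U → ℝ)
    (hη₁m : Measurable η₁) (hη₂m : Measurable η₂)
    (hη₁0 : ∀ p, 0 ≤ η₁ p) (hη₂0 : ∀ p, 0 ≤ η₂ p)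
    (hη₁ : π.bind (fun x => (Q₁ x).map (fun yu => (x, yu)))
      = (π.bind (fun x => (Q₁ x).map (fun yu => (x, yu)))
          + π.bind (fun y => (Q₂ y).map (fun xu => (xu.1, y, xu.2)))).withDensity
            (fun p => ENNReal.ofReal (η₁ p)))
    (ν₂ : Measure (X × X × U))
    (hν₂ : ν₂ = π.bind (fun x => (Q₂ x).map (fun yu => (x, yu)))
        + π.bind (fun y => (Q₁ y).map (fun xu => (xu.1, y, xu.2))))
    (hη₂ : π.bind (fun x => (Q₂ x).map (fun yu => (x, yu)))
      = ν₂.withDensity (fun p => ENNReal.ofReal (η₂ p))) :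
    ∀ᵐ p ∂ν₂, η₂ p = η₁ (p.1, p.2.1, e p.2.2) := by
  let F : X × X × U → X × X × U := fun p => (p.1, p.2.1, e p.2.2)
  let S : X × X × U → X × X × U := fun p => (p.2.1, p.1, p.2.2)
  have hF : Measurable F := by fun_prop
  have hS : Measurable S := by fun_prop
  have hFF (p : X × X × U) : F (F p) = p := by simp [F, hee]
  have swap (Q : Kernel X (X × U)) [IsMarkovKernel Q] :
      π.bind (fun y => (Q y).map (fun xu => (xu.1, y, xu.2)))
        = (π.bind (fun x => (Q x).map (fun yu => (x, yu)))).map S := by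
    rw [Measure.map_bind_of_measurable π Q.measurable_map_prodMk hS]
    congr 1
    funext y
    rw [Measure.map_map hS measurable_prodMk_left]
    rfl
  have prob (Q : Kernel X (X × U)) [IsMarkovKernel Q] :
      IsProbabilityMeasure (π.bind (fun x => (Q x).map (fun yu => (x, yu)))) := by
    refine isProbabilityMeasure_bind Q.measurable_map_prodMk.aemeasurable
      (Filter.Eventually.of_forall fun x => ?_)
    exact Measure.isProbabilityMeasure_map measurable_prodMk_left.aemeasurable
  have := prob Q₁
  have := prob Q₂
  rw [swap] at hη₁ hν₂
  generalize π.bind (fun x => (Q₁ x).map (fun yu => (x, yu))) = μ₁ at *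
  generalize π.bind (fun x => (Q₂ x).map (fun yu => (x, yu))) = μ₂ at *
  have hμ₂ : μ₂ = μ₁.map F := by
    have := Measure.isFiniteMeasure_map μ₁ F
    refine Measure.ext_of_forall_integral_bounded fun ψ hψ hb => ?_
    rw [hinv ψ hψ hb, integral_map hF.aemeasurable hψ.aestronglyMeasurable]
  have hμ₁ : μ₁ = μ₂.map F := by
    rw [hμ₂, Measure.map_map hF hF, show F ∘ F = id from funext hFF, Measure.map_id]
  have hν : ν₂ = (μ₁ + μ₂.map S).map F := by
    rw [hν₂, Measure.map_add _ _ hF, ← hμ₂, Measure.map_map hF hS, hμ₁, Measure.map_map hS hF]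
    rfl
  have hdens : μ₂ = ν₂.withDensity (fun p => ENNReal.ofReal (η₁ (F p))) := by
    rw [hν, ← Measure.map_withDensity_of_comp _ hF (by fun_prop)]
    simp only [hFF]
    rw [← hη₁, hμ₂]
  have : IsFiniteMeasure ν₂ := by
    have := Measure.isFiniteMeasure_map μ₁ S
    rw [hν₂]
    infer_instance
  have hae := (withDensity_eq_iff_of_sigmaFinite (by fun_prop) (by fun_prop)).1
    (hη₂.symm.trans hdens)
  filter_upwards [hae] with p hp
  exact (ENNReal.ofReal_eq_ofReal_iff (hη₂0 _) (hη₁0 _)).1 hp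
end

section
/- The pushforward of Π← under the order-reversing map R equals the forward path measure weighted by the product of Radon–Nikodym derivatives: R_*Π← = Π→ . withDensity( (x₀,…,x_τ) ↦ ∏_{t=0}^{τ} (dμ_{t+1}/dμ_t)(x_t) ). Equivalently, Π←(d(x_τ,…,x₀)) = ∏_{t=0}^{τ} (dμ_{t+1}/dμ_t)(x_t) · Π→(d(x₀,…,x_τ)). -/
open MeasureTheory ProbabilityTheory

/-- The law on `E^{n+1}` of an inhomogeneous Markov chain with initial distribution `μ0`
and transition kernels `κ 1, κ 2, …, κ n` (applied in this order). -/
noncomputable def chainLaw {E : Type*} [MeasurableSpace E] (μ0 : Measure E)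
    (κ : ℕ → E → Measure E) : (n : ℕ) → Measure (Fin (n + 1) → E)
  | 0 => μ0.map (fun x _ => x)
  | n + 1 => (chainLaw μ0 κ n).bind
      (fun p => (κ (n + 1) (p (Fin.last n))).map (fun x => Fin.snoc p x))

open scoped ENNReal

section ChainLaw

variable {E : Type*} [MeasurableSpace E]

lemma measurable_finSnoc (n : ℕ) :
    Measurable (fun z : (Fin n → E) × E => (Fin.snoc z.1 z.2 : Fin (n + 1) → E)) := by
  refine measurable_pi_iff.2 fun i => ?_
  induction i using Fin.lastCases with
  | last => simpa using measurable_snd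
  | cast i => simpa using (by fun_prop : Measurable fun z : (Fin n → E) × E => z.1 i)

lemma measurable_finCons (n : ℕ) :
    Measurable (fun z : E × (Fin n → E) => (Fin.cons z.1 z.2 : Fin (n + 1) → E)) := by
  refine measurable_pi_iff.2 fun i => ?_
  induction i using Fin.cases with
  | zero => simpa using measurable_fst
  | succ i => simpa using (by fun_prop : Measurable fun z : E × (Fin n → E) => z.2 i)

/-- For an s-finite kernel, the law of a point paired with its image under the kernel depends
measurably on the point, also after composition with a measurable map. -/
lemma measurable_map_kernel {α β γ : Type*} [MeasurableSpace α] [MeasurableSpace β]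
    [MeasurableSpace γ] (κ : Kernel α β) [IsSFiniteKernel κ] {g : α × β → γ}
    (hg : Measurable g) :
    Measurable (fun a => (κ a).map (fun b => g (a, b))) := by
  have h : (fun a => (κ a).map (fun b => g (a, b))) = ((Kernel.id ×ₖ κ).map g) := by
    ext1 a
    rw [Kernel.map_apply _ hg, Kernel.prod_apply, Kernel.id_apply, Measure.dirac_prod,
      Measure.map_map hg (by fun_prop)]
    rfl
  rw [h]
  exact Kernel.measurable _

variable (κ : ℕ → Kernel E E)

lemma lintegral_chainLaw_zero (m : Measure E) {f : (Fin 1 → E) → ℝ≥0∞} (hf : Measurable f) :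
    ∫⁻ p, f p ∂chainLaw m (fun t x => κ t x) 0 = ∫⁻ x, f (fun _ => x) ∂m :=
  lintegral_map hf (by fun_prop)

variable [∀ t, IsMarkovKernel (κ t)]

lemma measurable_chainLaw_step (n : ℕ) :
    Measurable (fun p : Fin (n + 1) → E =>
      ((κ (n + 1)) (p (Fin.last n))).map (fun x => (Fin.snoc p x : Fin (n + 2) → E))) :=
  measurable_map_kernel ((κ (n + 1)).comap (fun p : Fin (n + 1) → E => p (Fin.last n))
    (measurable_pi_apply _)) (measurable_finSnoc (n + 1))

lemma measurable_chainLaw (n : ℕ) :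
    Measurable (fun m : Measure E => chainLaw m (fun t x => κ t x) n) := by
  induction n with
  | zero => exact Measure.measurable_map _ (by fun_prop)
  | succ n ih => exact (Measure.measurable_bind' (measurable_chainLaw_step κ n)).comp ih

instance isProbabilityMeasure_chainLaw (m : Measure E) [IsProbabilityMeasure m] (n : ℕ) :
    IsProbabilityMeasure (chainLaw m (fun t x => κ t x) n) := by
  induction n with
  | zero => exact Measure.isProbabilityMeasure_map (by fun_prop)
  | succ n ih =>
    refine isProbabilityMeasure_bind (measurable_chainLaw_step κ n).aemeasurable
      (Filter.Eventually.of_forall fun p => ?_)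
    exact Measure.isProbabilityMeasure_map
      ((measurable_finSnoc (n + 1)).comp measurable_prodMk_left).aemeasurable

/-- The Markov kernel sending a point `x` to the law of the chain started at `x`. -/
noncomputable def chainKernel (n : ℕ) : Kernel E (Fin (n + 1) → E) where
  toFun x := chainLaw (Measure.dirac x) (fun t x => κ t x) n
  measurable' := (measurable_chainLaw κ n).comp Measure.measurable_dirac

lemma chainKernel_apply (n : ℕ) (x : E) :
    chainKernel κ n x = chainLaw (Measure.dirac x) (fun t x => κ t x) n := rfl

instance isMarkovKernel_chainKernel (n : ℕ) : IsMarkovKernel (chainKernel κ n) :=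
  ⟨fun x => isProbabilityMeasure_chainLaw κ (Measure.dirac x) n⟩

lemma lintegral_chainLaw_succ (m : Measure E) (n : ℕ) {f : (Fin (n + 2) → E) → ℝ≥0∞}
    (hf : Measurable f) :
    ∫⁻ p, f p ∂chainLaw m (fun t x => κ t x) (n + 1)
      = ∫⁻ p, ∫⁻ x, f (Fin.snoc p x) ∂κ (n + 1) (p (Fin.last n))
          ∂chainLaw m (fun t x => κ t x) n := by
  rw [chainLaw, Measure.lintegral_bind (measurable_chainLaw_step κ n).aemeasurable
    hf.aemeasurable]
  refine lintegral_congr fun p => ?_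
  exact lintegral_map hf ((measurable_finSnoc (n + 1)).comp measurable_prodMk_left)

lemma measurable_lintegral_snoc {α : Type*} [MeasurableSpace α] (η : Kernel E E)
    [IsMarkovKernel η] (n : ℕ) {f : α × (Fin (n + 2) → E) → ℝ≥0∞} (hf : Measurable f) :
    Measurable (fun z : α × (Fin (n + 1) → E) =>
      ∫⁻ x, f (z.1, Fin.snoc z.2 x) ∂η (z.2 (Fin.last n))) := by
  refine Measurable.lintegral_kernel_prod_right'
    (κ := η.comap (fun z : α × (Fin (n + 1) → E) => z.2 (Fin.last n)) (by fun_prop))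
    (f := fun w : (α × (Fin (n + 1) → E)) × E => f (w.1.1, Fin.snoc w.1.2 w.2)) ?_
  exact hf.comp ((measurable_fst.comp measurable_fst).prodMk
    ((measurable_finSnoc (n + 1)).comp
      ((measurable_snd.comp measurable_fst).prodMk measurable_snd)))

lemma measurable_lintegral_snoc' (η : Kernel E E) [IsMarkovKernel η] (n : ℕ)
    {f : (Fin (n + 2) → E) → ℝ≥0∞} (hf : Measurable f) :
    Measurable (fun p : Fin (n + 1) → E => ∫⁻ x, f (Fin.snoc p x) ∂η (p (Fin.last n))) :=
  (measurable_lintegral_snoc (α := Unit) η n (hf.comp measurable_snd)).comp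
    (measurable_prodMk_left (x := ()))

/-- Decomposition of the law of a chain according to its first step. -/
lemma lintegral_chainLaw_succ_head (m : Measure E) (n : ℕ) {f : (Fin (n + 2) → E) → ℝ≥0∞}
    (hf : Measurable f) :
    ∫⁻ p, f p ∂chainLaw m (fun t x => κ t x) (n + 1)
      = ∫⁻ x, ∫⁻ y, ∫⁻ p, f (Fin.cons x p) ∂chainKernel (fun t => κ (t + 1)) n y ∂κ 1 x ∂m := by
  have hcons : ∀ {n : ℕ} (x : E), Measurable (fun p => (Fin.cons x p : Fin (n + 1) → E)) :=
    fun x => (measurable_finCons _).comp measurable_prodMk_left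
  induction n with
  | zero =>
    rw [lintegral_chainLaw_succ κ m 0 hf,
      lintegral_chainLaw_zero κ m (measurable_lintegral_snoc' (κ 1) 0 hf)]
    refine lintegral_congr fun x => lintegral_congr fun y => ?_
    have hfx := hf.comp (hcons (n := 1) x)
    rw [chainKernel_apply]
    refine Eq.trans ?_ (lintegral_chainLaw_zero (fun t => κ (t + 1)) _ hfx).symm
    refine Eq.trans ?_ (lintegral_dirac' y (f := fun z => f (Fin.cons x fun _ => z))
      (hfx.comp (g := fun p : Fin 1 → E => f (Fin.cons x p)) (by fun_prop))).symm
    refine congrArg f ?_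
    ext i
    fin_cases i <;> rfl
  | succ n ih =>
    rw [lintegral_chainLaw_succ κ m (n + 1) hf, ih (measurable_lintegral_snoc' _ _ hf)]
    refine lintegral_congr fun x => lintegral_congr fun y => ?_
    have hfx := hf.comp (hcons (n := n + 2) x)
    rw [chainKernel_apply, chainKernel_apply]
    refine Eq.trans ?_ (lintegral_chainLaw_succ (fun t => κ (t + 1)) _ n hfx).symm
    refine lintegral_congr fun p => ?_
    rw [← Fin.succ_last, Fin.cons_succ]
    refine lintegral_congr fun z => ?_
    rw [Function.comp_apply, Fin.cons_snoc_eq_snoc_cons]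

lemma lintegral_chainKernel_initial (n : ℕ) (x : E) {G : E × (Fin (n + 1) → E) → ℝ≥0∞}
    (hG : Measurable G) :
    ∫⁻ p, G (p 0, p) ∂chainKernel κ n x = ∫⁻ p, G (x, p) ∂chainKernel κ n x := by
  simp only [chainKernel_apply]
  induction n with
  | zero =>
    rw [lintegral_chainLaw_zero κ _ (f := fun p => G (p 0, p)) (by fun_prop),
      lintegral_chainLaw_zero κ _ (f := fun p => G (x, p)) (by fun_prop),
      lintegral_dirac' _ (f := fun y => G (y, fun _ => y)) (by fun_prop),
      lintegral_dirac' _ (f := fun y => G (x, fun _ => y)) (by fun_prop)]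
  | succ n ih =>
    rw [lintegral_chainLaw_succ κ _ n (f := fun p => G (p 0, p)) (by fun_prop),
      lintegral_chainLaw_succ κ _ n (f := fun p => G (x, p)) (by fun_prop),
      ← ih (measurable_lintegral_snoc (κ (n + 1)) n hG)]
    refine lintegral_congr fun p => lintegral_congr fun y => ?_
    rw [← Fin.castSucc_zero, Fin.snoc_castSucc]

/-- Disintegration of the law of a chain with respect to its initial point. -/
lemma lintegral_chainLaw_eq (m : Measure E) (n : ℕ) {f : (Fin (n + 1) → E) → ℝ≥0∞}
    (hf : Measurable f) :
    ∫⁻ p, f p ∂chainLaw m (fun t x => κ t x) n = ∫⁻ x, ∫⁻ p, f p ∂chainKernel κ n x ∂m := by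
  simp only [chainKernel_apply]
  induction n with
  | zero =>
    simp only [lintegral_chainLaw_zero κ _ hf]
    refine lintegral_congr fun x => ?_
    rw [lintegral_dirac' _ (f := fun y => f fun _ => y) (by fun_prop)]
  | succ n ih =>
    simp only [lintegral_chainLaw_succ κ _ n hf]
    exact ih (measurable_lintegral_snoc' _ _ hf)

lemma lintegral_chainLaw_initial (m : Measure E) (n : ℕ) {G : E × (Fin (n + 1) → E) → ℝ≥0∞}
    (hG : Measurable G) :
    ∫⁻ p, G (p 0, p) ∂chainLaw m (fun t x => κ t x) n
      = ∫⁻ x, ∫⁻ p, G (x, p) ∂chainKernel κ n x ∂m := by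
  rw [lintegral_chainLaw_eq κ m n (f := fun p => G (p 0, p)) (by fun_prop)]
  exact lintegral_congr fun x => lintegral_chainKernel_initial κ n x hG

/-- Changing the initial distribution reweights the path law by the density at time zero. -/
lemma lintegral_chainLaw_rnDeriv_mul (m m' : Measure E) [IsProbabilityMeasure m]
    [IsProbabilityMeasure m'] (h : m' ≪ m) (n : ℕ) {f : (Fin (n + 1) → E) → ℝ≥0∞}
    (hf : Measurable f) :
    ∫⁻ p, m'.rnDeriv m (p 0) * f p ∂chainLaw m (fun t x => κ t x) n
      = ∫⁻ p, f p ∂chainLaw m' (fun t x => κ t x) n := by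
  have hd := Measure.measurable_rnDeriv m' m
  rw [lintegral_chainLaw_initial κ m n (G := fun z => m'.rnDeriv m z.1 * f z.2) (by fun_prop),
    lintegral_chainLaw_eq κ m' n hf, ← lintegral_rnDeriv_mul h hf.lintegral_kernel.aemeasurable]
  exact lintegral_congr fun x => lintegral_const_mul (m'.rnDeriv m x) hf

end ChainLaw

lemma lintegral_lintegral_swap_of_reversible {E : Type*} [MeasurableSpace E] (m : Measure E)
    (η : Kernel E E) [IsMarkovKernel η]
    (h : (m.bind (fun x => (η x).map (fun y => (x, y)))).map Prod.swap
      = m.bind (fun x => (η x).map (fun y => (x, y))))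
    {g : E × E → ℝ≥0∞} (hg : Measurable g) :
    ∫⁻ x, ∫⁻ y, g (x, y) ∂η x ∂m = ∫⁻ x, ∫⁻ y, g (y, x) ∂η x ∂m := by
  have key : ∀ {g : E × E → ℝ≥0∞}, Measurable g →
      ∫⁻ z, g z ∂m.bind (fun x => (η x).map (fun y => (x, y)))
        = ∫⁻ x, ∫⁻ y, g (x, y) ∂η x ∂m := by
    intro g hg
    rw [Measure.lintegral_bind (measurable_map_kernel η (g := fun z => z) measurable_id).aemeasurable
      hg.aemeasurable]
    exact lintegral_congr fun x => lintegral_map hg measurable_prodMk_left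
  rw [← key hg, ← h, lintegral_map hg measurable_swap]
  exact key (hg.comp measurable_swap)

lemma lintegral_reverse_chainLaw {E : Type*} [MeasurableSpace E] (τ : ℕ)
    (μ : ℕ → Measure E) [∀ t, IsProbabilityMeasure (μ t)]
    (hac : ∀ t ≤ τ, μ (t + 1) ≪ μ t)
    (κ : ℕ → Kernel E E) [∀ t, IsMarkovKernel (κ t)]
    (hrev : ∀ t, 1 ≤ t → t ≤ τ →
      ((μ t).bind (fun x => ((κ t) x).map (fun y => (x, y)))).map Prod.swap
        = (μ t).bind (fun x => ((κ t) x).map (fun y => (x, y))))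
    {f : (Fin (τ + 1) → E) → ℝ≥0∞} (hf : Measurable f) :
    ∫⁻ p, f (fun i => p i.rev) ∂chainLaw (μ (τ + 1)) (fun t x => (κ (τ + 1 - t)) x) τ
      = ∫⁻ p, (∏ t : Fin (τ + 1), (μ ((t : ℕ) + 1)).rnDeriv (μ (t : ℕ)) (p t)) * f p
          ∂chainLaw (μ 0) (fun t x => (κ t) x) τ := by
  have hw : ∀ t, Measurable ((μ (t + 1)).rnDeriv (μ t)) :=
    fun t => Measure.measurable_rnDeriv _ _
  induction τ with
  | zero =>
    have hw0 := hw 0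
    rw [lintegral_chainLaw_zero (fun t => κ (0 + 1 - t)) _ (f := fun p => f fun i => p i.rev)
        (by fun_prop),
      lintegral_chainLaw_zero κ _ (f := fun p =>
        (∏ t : Fin 1, (μ ((t : ℕ) + 1)).rnDeriv (μ (t : ℕ)) (p t)) * f p) (by fun_prop),
      ← lintegral_rnDeriv_mul (hac 0 le_rfl) (f := fun x => f fun _ => x)
        (by fun_prop)]
    simp
  | succ τ ih =>
    set w := (μ (τ + 1 + 1)).rnDeriv (μ (τ + 1))
    have hw_meas : Measurable w := hw (τ + 1)
    let k : (Fin (τ + 2) → E) → ℝ≥0∞ := fun q => w (q (Fin.last (τ + 1))) * f q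
    have hk : Measurable k := by fun_prop
    have hcons_rev : ∀ (x : E) (p : Fin (τ + 1) → E),
        (fun i => (Fin.cons x p : Fin (τ + 2) → E) (Fin.rev i))
          = Fin.snoc (fun i => p i.rev) x := by
      intro x p
      ext i
      induction i using Fin.lastCases with
      | last => simp
      | cast i => simp [Fin.rev_castSucc]
    have hk_rev : Measurable
        (fun z : (Fin (τ + 1) → E) × E => k (Fin.snoc (fun i => z.1 i.rev) z.2)) := by
      have hrev_fst : Measurable
          (fun z : (Fin (τ + 1) → E) × E => (fun i : Fin (τ + 1) => z.1 i.rev, z.2)) := by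
        fun_prop
      exact hk.comp ((measurable_finSnoc (τ + 1)).comp hrev_fst)
    have hk_swap : Measurable (fun z : E × E =>
        ∫⁻ p, k (Fin.snoc (fun i => p i.rev) z.1)
          ∂chainKernel (fun t => κ (τ + 1 - t)) τ z.2) :=
      Measurable.lintegral_kernel_prod_right'
        (κ := (chainKernel (fun t => κ (τ + 1 - t)) τ).comap Prod.snd measurable_snd)
        (f := fun u : (E × E) × (Fin (τ + 1) → E) =>
          k (Fin.snoc (fun i => u.2 i.rev) u.1.1))
        (hk_rev.comp (measurable_snd.prodMk (measurable_fst.comp measurable_fst)))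
    have hk_step : Measurable (fun z : E × (Fin (τ + 1) → E) =>
        ∫⁻ y, k (Fin.snoc (fun i => z.2 i.rev) y) ∂κ (τ + 1) z.1) :=
      Measurable.lintegral_kernel_prod_right'
        (κ := (κ (τ + 1)).comap Prod.fst measurable_fst)
        (f := fun u : (E × (Fin (τ + 1) → E)) × E =>
          k (Fin.snoc (fun i => u.1.2 i.rev) u.2))
        (hk_rev.comp ((measurable_snd.comp measurable_fst).prodMk measurable_snd))
    calc
      _ = ∫⁻ p, k (fun i => p i.rev)
          ∂chainLaw (μ (τ + 1)) (fun t x => (κ (τ + 1 + 1 - t)) x) (τ + 1) := by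
        rw [← lintegral_chainLaw_rnDeriv_mul (fun t => κ (τ + 1 + 1 - t)) (μ (τ + 1)) _
          (hac (τ + 1) le_rfl) (τ + 1) (f := fun p => f fun i => p i.rev) (by fun_prop)]
        simp only [k, Fin.rev_last, w]
      _ = ∫⁻ x, ∫⁻ y, ∫⁻ p, k (Fin.snoc (fun i => p i.rev) x)
          ∂chainKernel (fun t => κ (τ + 1 - t)) τ y ∂κ (τ + 1) x ∂μ (τ + 1) := by
        rw [lintegral_chainLaw_succ_head (fun t => κ (τ + 1 + 1 - t)) _ τ
          (f := fun p => k fun i => p i.rev) (by fun_prop)]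
        simp only [hcons_rev, Nat.add_sub_add_right, Nat.add_sub_cancel]
      _ = ∫⁻ x, ∫⁻ y, ∫⁻ p, k (Fin.snoc (fun i => p i.rev) y)
          ∂chainKernel (fun t => κ (τ + 1 - t)) τ x ∂κ (τ + 1) x ∂μ (τ + 1) :=
        lintegral_lintegral_swap_of_reversible _ _ (hrev (τ + 1) (by omega) le_rfl) hk_swap
      _ = ∫⁻ x, ∫⁻ p, ∫⁻ y, k (Fin.snoc (fun i => p i.rev) y)
          ∂κ (τ + 1) x ∂chainKernel (fun t => κ (τ + 1 - t)) τ x ∂μ (τ + 1) :=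
        lintegral_congr fun x =>
          lintegral_lintegral_swap (hk_rev.comp measurable_swap).aemeasurable
      _ = ∫⁻ p, ∫⁻ y, k (Fin.snoc (fun i => p i.rev) y) ∂κ (τ + 1) (p (Fin.last τ).rev)
          ∂chainLaw (μ (τ + 1)) (fun t x => (κ (τ + 1 - t)) x) τ := by
        rw [Fin.rev_last]
        exact (lintegral_chainLaw_initial (fun t => κ (τ + 1 - t)) _ τ hk_step).symm
      _ = ∫⁻ p, (∏ t : Fin (τ + 1), (μ ((t : ℕ) + 1)).rnDeriv (μ (t : ℕ)) (p t)) *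
            ∫⁻ y, k (Fin.snoc p y) ∂κ (τ + 1) (p (Fin.last τ))
          ∂chainLaw (μ 0) (fun t x => (κ t) x) τ :=
        ih (fun t ht => hac t (by omega)) (fun t h1 ht => hrev t h1 (by omega))
          (measurable_lintegral_snoc' (κ (τ + 1)) τ hk)
      _ = _ := by
        rw [lintegral_chainLaw_succ κ _ τ (by fun_prop)]
        refine lintegral_congr fun p => ?_
        refine (lintegral_const_mul _
          (hk.comp ((measurable_finSnoc (τ + 1)).comp measurable_prodMk_left))).symm.trans ?_
        refine lintegral_congr fun y => ?_
        rw [Fin.prod_univ_castSucc (n := τ + 1)]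
        simp [k, w, mul_assoc]

/-- **Justification of Annealed Importance Sampling (Theorem `thm:AIS` of
Andrieu, Doucet, Yıldırım & Chopin).**

Let `μ 0, …, μ (τ+1)` be probability measures on `E` with `μ (t+1) ≪ μ t` for `t ≤ τ`, and
`κ 1, …, κ τ` Markov kernels with `κ t` reversible w.r.t. `μ t`.  Let
`Π→ = μ 0 ⊗ κ 1 ⊗ ⋯ ⊗ κ τ` and `Π← = μ (τ+1) ⊗ κ τ ⊗ ⋯ ⊗ κ 1` be the forward and backward
path laws on `E^{τ+1}`, and `R` the order-reversing map.  Then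
`R_* Π← = Π→.withDensity (fun x => ∏_{t=0}^{τ} (dμ_{t+1}/dμ_t)(x_t))`. -/
theorem ais_path_identity {E : Type*} [MeasurableSpace E] (τ : ℕ)
    (μ : ℕ → Measure E) [∀ t, IsProbabilityMeasure (μ t)]
    (hac : ∀ t ≤ τ, μ (t + 1) ≪ μ t)
    (κ : ℕ → Kernel E E) [∀ t, IsMarkovKernel (κ t)]
    (hrev : ∀ t, 1 ≤ t → t ≤ τ →
      ((μ t).bind (fun x => ((κ t) x).map (fun y => (x, y)))).map Prod.swap
        = (μ t).bind (fun x => ((κ t) x).map (fun y => (x, y)))) :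
    (chainLaw (μ (τ + 1)) (fun t x => (κ (τ + 1 - t)) x) τ).map
        (fun p (i : Fin (τ + 1)) => p i.rev)
      = (chainLaw (μ 0) (fun t x => (κ t) x) τ).withDensity
          (fun p => ∏ t : Fin (τ + 1),
            (μ ((t : ℕ) + 1)).rnDeriv (μ (t : ℕ)) (p t)) := by
  have hw : ∀ t, Measurable ((μ (t + 1)).rnDeriv (μ t)) :=
    fun t => Measure.measurable_rnDeriv _ _
  refine Measure.ext_of_lintegral _ fun f hf => ?_
  rw [lintegral_map hf (by fun_prop), lintegral_reverse_chainLaw τ μ hac κ hrev hf,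
    lintegral_withDensity_eq_lintegral_mul _ (by fun_prop) hf]
  rfl
end

section
/- For every N ≥ 1, as measures on X × X × U^N × {1,…,N} (coordinates (x, y, 𝔲, k)): π(dy) Q₂^N(y, d(x, 𝔲, k)) = r̊^N(x,y,𝔲) · π(dx) Q₁^N(x, d(y, 𝔲, k)); that is, for every bounded measurable h, ∫ h(x,y,𝔲,k) π(dy) Q₂^N(y, d(x,𝔲,k)) = ∫ h(x,y,𝔲,k) r̊^N(x,y,𝔲) π(dx) Q₁^N(x, d(y,𝔲,k)). -/
open MeasureTheory ProbabilityTheory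
open scoped ENNReal

namespace MHAAR

variable {A B Z : Type*} [MeasurableSpace A] [MeasurableSpace B] [MeasurableSpace Z]

lemma measurable_smul_measure {c : A → ℝ≥0∞} {M : A → Measure Z} (hc : Measurable c)
    (hM : Measurable M) : Measurable fun a => c a • M a :=
  Measure.measurable_of_measurable_coe _ fun _ hs =>
    hc.mul ((Measure.measurable_coe hs).comp hM)

lemma measurable_bind_kernel (κ : Kernel A B) [IsSFiniteKernel κ] {M : A × B → Measure Z}
    (hM : Measurable M) : Measurable fun a => (κ a).bind fun b => M (a, b) := by
  refine Measure.measurable_of_measurable_coe _ fun s hs => ?_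
  have h : ∀ a, (κ a).bind (fun b => M (a, b)) s = ∫⁻ b, M (a, b) s ∂κ a := fun a =>
    Measure.bind_apply hs (hM.comp measurable_prodMk_left).aemeasurable
  simp_rw [h]
  have hMs : Measurable fun p => M p s := (Measure.measurable_coe hs).comp hM
  exact Measurable.lintegral_kernel_prod_right' (κ := κ) hMs

lemma measurable_map_kernel (κ : Kernel A B) [IsSFiniteKernel κ] {g : A × B → Z}
    (hg : Measurable g) : Measurable fun a => (κ a).map fun b => g (a, b) := by
  have h : ∀ a, (κ a).map (fun b => g (a, b)) = (κ a).bind fun b => Measure.dirac (g (a, b)) :=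
    fun a => (Measure.bind_dirac_eq_map _ (hg.comp measurable_prodMk_left)).symm
  rw [funext h]
  exact measurable_bind_kernel κ (M := fun p => Measure.dirac (g p))
    (Measure.measurable_dirac.comp hg)

lemma lintegral_bind_bind (π : Measure A) (κ : Kernel A B) [IsSFiniteKernel κ]
    {M : A × B → Measure Z} (hM : Measurable M) {f : Z → ℝ≥0∞} (hf : Measurable f) :
    ∫⁻ z, f z ∂(π.bind fun a => (κ a).bind fun b => M (a, b))
      = ∫⁻ a, ∫⁻ b, ∫⁻ z, f z ∂M (a, b) ∂κ a ∂π := by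
  rw [Measure.lintegral_bind (measurable_bind_kernel κ hM).aemeasurable hf.aemeasurable]
  exact lintegral_congr fun a => Measure.lintegral_bind
    (hM.comp measurable_prodMk_left).aemeasurable hf.aemeasurable

lemma measurable_pi_kernel {ι : Type*} [Fintype ι] (κ : ι → Kernel A B)
    [∀ i, IsMarkovKernel (κ i)] : Measurable fun a => Measure.pi fun i => κ i a := by
  refine Measurable.measure_of_isPiSystem_of_isProbabilityMeasure generateFrom_pi.symm
    isPiSystem_pi ?_
  rintro _ ⟨s, hs, rfl⟩
  simp_rw [Measure.pi_pi]
  exact Finset.measurable_prod _ fun i _ => (κ i).measurable_coe (hs i trivial)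

/-- The product kernel `a ↦ ⨂ᵢ κ i a` of a finite family of Markov kernels. -/
noncomputable def piKernel {ι : Type*} [Fintype ι] (κ : ι → Kernel A B)
    [∀ i, IsMarkovKernel (κ i)] : Kernel A (ι → B) where
  toFun a := Measure.pi fun i => κ i a
  measurable' := measurable_pi_kernel κ

instance {ι : Type*} [Fintype ι] (κ : ι → Kernel A B) [∀ i, IsMarkovKernel (κ i)] :
    IsMarkovKernel (piKernel κ) :=
  ⟨fun a => inferInstanceAs (IsProbabilityMeasure (Measure.pi fun i => κ i a))⟩

lemma pi_update_eq_map {ι : Type*} [Fintype ι] [DecidableEq ι] (ν : ι → Measure B)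
    [∀ i, IsProbabilityMeasure (ν i)] (k : ι) (μ : Measure B) [IsProbabilityMeasure μ] :
    Measure.pi (fun i => if i = k then μ else ν i)
      = (μ.prod (Measure.pi ν)).map fun p => Function.update p.2 k p.1 := by
  have hm : Measurable fun p : B × (ι → B) => Function.update p.2 k p.1 :=
    measurable_update'.comp measurable_swap
  have hP : ∀ i, IsProbabilityMeasure (if i = k then μ else ν i) := fun i => by
    split_ifs <;> infer_instance
  refine Measure.pi_eq fun s hs => ?_
  have hpre : (fun p : B × (ι → B) => Function.update p.2 k p.1) ⁻¹' Set.univ.pi s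
      = s k ×ˢ Set.univ.pi (Function.update s k Set.univ) := by
    ext ⟨u, v⟩
    simp only [Set.mem_preimage, Set.mem_univ_pi, Set.mem_prod]
    constructor
    · refine fun h => ⟨by simpa using h k, fun i => ?_⟩
      by_cases hi : i = k
      · subst hi; simp
      · simpa [hi] using h i
    · rintro ⟨h1, h2⟩ i
      by_cases hi : i = k
      · subst hi; simpa using h1
      · simpa [hi] using h2 i
  rw [Measure.map_apply hm (MeasurableSet.univ_pi hs), hpre, Measure.prod_prod, Measure.pi_pi,
    ← Finset.mul_prod_erase Finset.univ _ (Finset.mem_univ k),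
    ← Finset.mul_prod_erase Finset.univ (fun i => (if i = k then μ else ν i) (s i))
      (Finset.mem_univ k)]
  simp only [Function.update_self, measure_univ, one_mul, if_true]
  congr 1
  refine Finset.prod_congr rfl fun i hi => ?_
  simp [Finset.ne_of_mem_erase hi]

lemma lintegral_pi_update {ι : Type*} [Fintype ι] [DecidableEq ι] (ν : ι → Measure B)
    [∀ i, IsProbabilityMeasure (ν i)] (k : ι) (μ : Measure B) [IsProbabilityMeasure μ]
    {g : (ι → B) → ℝ≥0∞} (hg : Measurable g) :
    ∫⁻ v, g v ∂Measure.pi (fun i => if i = k then μ else ν i)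
      = ∫⁻ u, ∫⁻ v, g (Function.update v k u) ∂Measure.pi ν ∂μ := by
  have hm : Measurable fun p : B × (ι → B) => Function.update p.2 k p.1 :=
    measurable_update'.comp measurable_swap
  have hgm : Measurable fun p : B × (ι → B) => g (Function.update p.2 k p.1) := hg.comp hm
  rw [pi_update_eq_map, lintegral_map hg hm, lintegral_prod _ hgm.aemeasurable]

/-- Reweighting by the selection probability and the averaged ratio amounts to reweighting by the
ratio at the selected index. -/
lemma ofReal_selection_mul_ofReal_average {N : ℕ} (hN : 1 ≤ N) (a : Fin N → ℝ)
    (ha : ∀ i, 0 ≤ a i) (k : Fin N) :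
    ENNReal.ofReal (if 0 < ∑ i, a i then a k / ∑ i, a i else (N : ℝ)⁻¹)
        * ENNReal.ofReal ((N : ℝ)⁻¹ * ∑ i, a i)
      = (N : ℝ≥0∞)⁻¹ * ENNReal.ofReal (a k) := by
  have hN' : (0 : ℝ) < N := by exact_mod_cast hN
  have hN'' : (N : ℝ≥0∞)⁻¹ = ENNReal.ofReal (N : ℝ)⁻¹ := by
    rw [ENNReal.ofReal_inv_of_pos hN', ENNReal.ofReal_natCast]
  rw [hN'', ← ENNReal.ofReal_mul (inv_nonneg.2 hN'.le)]
  split_ifs with h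
  · rw [← ENNReal.ofReal_mul (div_nonneg (ha k) h.le)]
    congr 1
    field_simp
  · have h0 : ∑ i, a i = 0 := le_antisymm (not_lt.1 h) (Finset.sum_nonneg fun i _ => ha i)
    have hk : a k = 0 := (Finset.sum_eq_zero_iff_of_nonneg fun i _ => ha i).1 h0 k
      (Finset.mem_univ k)
    simp [h0, hk]

/-- The averaged-ratio identity at a fixed pair of states. -/
lemma lintegral_ratio_mul_sum {N : ℕ} (hN : 1 ≤ N) (ν : Measure B) [IsProbabilityMeasure ν]
    {ρ : B → ℝ} (hρm : Measurable ρ) (hρ : ∀ u, 0 ≤ ρ u)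
    {φ : (Fin N → B) × Fin N → ℝ≥0∞} (hφ : Measurable φ) :
    ∫⁻ u, ENNReal.ofReal (ρ u) * ∑ k, (N : ℝ≥0∞)⁻¹ *
        ∫⁻ v, φ (Function.update v k u, k) ∂Measure.pi (fun _ : Fin N => ν) ∂ν
      = ∫⁻ v, ∑ k, ENNReal.ofReal
          (if 0 < ∑ i, ρ (v i) then ρ (v k) / ∑ i, ρ (v i) else (N : ℝ)⁻¹) *
            (ENNReal.ofReal ((N : ℝ)⁻¹ * ∑ i, ρ (v i)) * φ (v, k))
          ∂Measure.pi (fun _ : Fin N => ν) := by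
  have hφk : ∀ k, Measurable fun v => φ (v, k) := fun k => hφ.comp (by fun_prop)
  have hm : ∀ k : Fin N, Measurable fun p : B × (Fin N → B) => Function.update p.2 k p.1 :=
    fun k => measurable_update'.comp measurable_swap
  have hg : ∀ k, Measurable fun v : Fin N → B => ENNReal.ofReal (ρ (v k)) * φ (v, k) :=
    fun k => (hρm.comp (measurable_pi_apply k)).ennreal_ofReal.mul (hφk k)
  have hG : ∀ k : Fin N, Measurable fun u =>
      ∫⁻ v, φ (Function.update v k u, k) ∂Measure.pi (fun _ : Fin N => ν) :=
    fun k => ((hφk k).comp (hm k)).lintegral_prod_right'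
  have hρG : ∀ k : Fin N, Measurable fun u => ENNReal.ofReal (ρ u) * ((N : ℝ≥0∞)⁻¹ *
      ∫⁻ v, φ (Function.update v k u, k) ∂Measure.pi (fun _ : Fin N => ν)) :=
    fun k => hρm.ennreal_ofReal.mul ((hG k).const_mul _)
  have hH : ∀ k : Fin N, Measurable fun u =>
      ∫⁻ v, ENNReal.ofReal (ρ u) * φ (Function.update v k u, k)
        ∂Measure.pi (fun _ : Fin N => ν) := fun k =>
    ((hρm.comp measurable_fst).ennreal_ofReal.mul ((hφk k).comp (hm k))).lintegral_prod_right'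
  simp_rw [← mul_assoc, ofReal_selection_mul_ofReal_average hN _ (fun i => hρ _), mul_assoc,
    Finset.mul_sum]
  rw [lintegral_finsetSum _ fun k _ => hρG k,
    lintegral_finsetSum _ fun k _ => (hg k).const_mul _]
  refine Finset.sum_congr rfl fun k _ => ?_
  have h := lintegral_pi_update (fun _ : Fin N => ν) k ν (hg k)
  simp only [ite_self, Function.update_self] at h
  rw [lintegral_const_mul _ (hg k), h, ← lintegral_const_mul _ (hH k)]
  refine lintegral_congr fun u => ?_
  have hu : Measurable fun v : Fin N → B => φ (Function.update v k u, k) :=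
    (hφk k).comp ((hm k).comp measurable_prodMk_left)
  rw [lintegral_const_mul _ hu, mul_left_comm]

end MHAAR

/-- **The averaged acceptance-ratio identity for MHAAR
(Andrieu, Doucet, Yıldırım & Chopin, proof of Theorem 1, eq. (12)).**

Let `π` be a probability measure on `X`, `q` a Markov proposal kernel on `X`,
`(x,y) ↦ Q (x,y)` a Markov kernel from `X × X` to `U`, `e : U → U` a measurable involution
with `Q̄_{x,y} = e_* Q_{x,y}`, and `r : X × X × U → [0,∞)` such that, as measures with
coordinates `(x,y,u)`, `π(dy) q(y,dx) Q̄_{y,x}(du) = r(x,y,u) ⬝ π(dx) q(x,dy) Q_{x,y}(du)`.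
Then, for every `N ≥ 1`, with `Q₁^N, Q₂^N` as in Algorithm 1 and
`r̊^N(x,y,us) = N⁻¹ ∑ᵢ r(x,y,u⁽ⁱ⁾)`, as measures with coordinates `(x,y,us,k)`:
`π(dy) Q₂^N(y, d(x,us,k)) = r̊^N(x,y,us) ⬝ π(dx) Q₁^N(x, d(y,us,k))`. -/
theorem mhaar_averaged_ratio_identity
    {X U : Type*} [MeasurableSpace X] [MeasurableSpace U]
    (π : Measure X) [IsProbabilityMeasure π]
    (q : Kernel X X) [IsMarkovKernel q]
    (Q : Kernel (X × X) U) [IsMarkovKernel Q]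
    (e : U → U) (hem : Measurable e) (hee : ∀ u, e (e u) = u)
    (r : X → X → U → ℝ)
    (hrm : Measurable (fun p : X × X × U => r p.1 p.2.1 p.2.2))
    (hr0 : ∀ x y u, 0 ≤ r x y u)
    (hkey : π.bind (fun y => (q y).bind (fun x =>
        ((Q (y, x)).map e).map (fun u => (x, y, u))))
      = (π.bind (fun x => (q x).bind (fun y =>
          (Q (x, y)).map (fun u => (x, y, u))))).withDensity
          (fun p => ENNReal.ofReal (r p.1 p.2.1 p.2.2)))
    (N : ℕ) (hN : 1 ≤ N)
    (w : X → X → (Fin N → U) → Fin N → ℝ)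
    (hw : ∀ x y us k, w x y us k =
      if 0 < ∑ i, r x y (us i) then r x y (us k) / ∑ i, r x y (us i) else (N : ℝ)⁻¹)
    (rN : X → X → (Fin N → U) → ℝ)
    (hrN : ∀ x y us, rN x y us = (N : ℝ)⁻¹ * ∑ i, r x y (us i)) :
    -- `π(dy) Q₂^N(y, d(x,us,k))`
    π.bind (fun y => (q y).bind (fun x =>
        ∑ k : Fin N, ((N : ℝ≥0∞))⁻¹ •
          ((Measure.pi (fun i : Fin N =>
              if i = k then (Q (y, x)).map e else Q (x, y))).map
            (fun us => (x, y, us, k)))))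
    -- `r̊^N(x,y,us) ⬝ π(dx) Q₁^N(x, d(y,us,k))`
    = ((π.bind (fun x => (q x).bind (fun y =>
          (Measure.pi (fun _ : Fin N => Q (x, y))).bind (fun us =>
            ∑ k : Fin N, ENNReal.ofReal (w x y us k) •
              Measure.dirac (x, y, us, k))))).withDensity
        (fun p : X × X × (Fin N → U) × Fin N =>
          ENNReal.ofReal (rN p.1 p.2.1 p.2.2.1))) := by
  let Qe : Kernel (X × X) U := Q.map e
  have hQe : ∀ p, Qe p = (Q p).map e := fun p => Kernel.map_apply Q hem p
  have : IsMarkovKernel Qe := Kernel.IsMarkovKernel.map Q hem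
  let Qs : Kernel (X × X) U := Q.comap Prod.swap measurable_swap
  let K : Kernel (X × X) (Fin N → U) := MHAAR.piKernel fun _ => Q
  let J : Fin N → Fin N → Kernel (X × X) U := fun k i => if i = k then Qe else Qs
  have hJ : ∀ k i, IsMarkovKernel (J k i) := fun k i => by
    dsimp only [J]; split_ifs <;> infer_instance
  have hrim : ∀ i : Fin N, Measurable fun p : X × X × (Fin N → U) × Fin N =>
      r p.1 p.2.1 (p.2.2.1 i) := fun i => hrm.comp
    (g := fun p : X × X × U => r p.1 p.2.1 p.2.2)
    (f := fun p : X × X × (Fin N → U) × Fin N => (p.1, p.2.1, p.2.2.1 i)) (by fun_prop)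
  have hSm : Measurable fun p : X × X × (Fin N → U) × Fin N =>
      ∑ i, r p.1 p.2.1 (p.2.2.1 i) := Finset.measurable_sum _ fun i _ => hrim i
  have hwm : ∀ k, Measurable fun p : X × X × (Fin N → U) × Fin N => w p.1 p.2.1 p.2.2.1 k := by
    intro k
    simp_rw [hw]
    exact Measurable.ite (measurableSet_lt measurable_const hSm) ((hrim k).div hSm)
      measurable_const
  have hd : Measurable fun p : X × X × (Fin N → U) × Fin N =>
      ENNReal.ofReal (rN p.1 p.2.1 p.2.2.1) := by
    simp_rw [hrN]
    exact (hSm.const_mul _).ennreal_ofReal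
  have hrd : Measurable fun p : X × X × U => ENNReal.ofReal (r p.1 p.2.1 p.2.2) :=
    hrm.ennreal_ofReal
  have hkey' : ∀ g : X × X × U → ℝ≥0∞, Measurable g →
      ∫⁻ y, ∫⁻ x, ∫⁻ u, g (x, y, u) ∂(Q (y, x)).map e ∂q y ∂π
        = ∫⁻ x, ∫⁻ y, ∫⁻ u, ENNReal.ofReal (r x y u) * g (x, y, u) ∂Q (x, y) ∂q x ∂π := by
    intro g hg
    have h1 : Measurable fun p : X × X =>
        ((Q (p.1, p.2)).map e).map fun u => (p.2, p.1, u) := by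
      have := MHAAR.measurable_map_kernel Qe
        (g := fun p : (X × X) × U => (p.1.2, p.1.1, p.2)) (by fun_prop)
      simpa only [hQe] using this
    have h2 : Measurable fun p : X × X => (Q (p.1, p.2)).map fun u => (p.1, p.2, u) :=
      MHAAR.measurable_map_kernel Q
        (g := fun p : (X × X) × U => (p.1.1, p.1.2, p.2)) (by fun_prop)
    have h := congrArg (fun m => ∫⁻ p, g p ∂m) hkey
    rw [lintegral_withDensity_eq_lintegral_mul _ hrd hg,
      MHAAR.lintegral_bind_bind π q h1 hg,
      MHAAR.lintegral_bind_bind π q h2 (hrd.mul hg)] at h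
    convert h using 6 with y x x y
    · rw [lintegral_map hg (by fun_prop)]
    · rw [lintegral_map (hrd.mul hg) (by fun_prop)]
      rfl
  refine Measure.ext_of_lintegral _ fun f hf => ?_
  have hM1 : Measurable fun p : X × X => ∑ k : Fin N, ((N : ℝ≥0∞))⁻¹ •
      ((Measure.pi (fun i : Fin N =>
        if i = k then (Q (p.1, p.2)).map e else Q (p.2, p.1))).map
          (fun us => (p.2, p.1, us, k))) := by
    refine Finset.measurable_sum _ fun k _ => MHAAR.measurable_smul_measure measurable_const ?_
    have := MHAAR.measurable_map_kernel (MHAAR.piKernel (J k))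
      (g := fun p : (X × X) × (Fin N → U) => (p.1.2, p.1.1, p.2, k)) (by fun_prop)
    convert this using 3 with p
    refine congrArg Measure.pi (funext fun i => ?_)
    dsimp only [J]
    split_ifs
    · exact (hQe p).symm
    · rfl
  have hL : Measurable fun p : (X × X) × (Fin N → U) =>
      ∑ k : Fin N, ENNReal.ofReal (w p.1.1 p.1.2 p.2 k) •
        Measure.dirac (p.1.1, p.1.2, p.2, k) := by
    refine Finset.measurable_sum _ fun k _ => ?_
    have hr : Measurable fun p : (X × X) × (Fin N → U) => (p.1.1, p.1.2, p.2, k) := by fun_prop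
    have hwk : Measurable fun p : (X × X) × (Fin N → U) =>
        ENNReal.ofReal (w p.1.1 p.1.2 p.2 k) := ((hwm k).comp hr).ennreal_ofReal
    have hδ : Measurable fun p : (X × X) × (Fin N → U) =>
        Measure.dirac (p.1.1, p.1.2, p.2, k) := Measure.measurable_dirac.comp hr
    exact MHAAR.measurable_smul_measure hwk hδ
  have hM2 : Measurable fun p : X × X => (Measure.pi (fun _ : Fin N => Q (p.1, p.2))).bind
      fun us => ∑ k : Fin N, ENNReal.ofReal (w p.1 p.2 us k) •
        Measure.dirac (p.1, p.2, us, k) :=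
    MHAAR.measurable_bind_kernel K (M := fun p => ∑ k : Fin N,
      ENNReal.ofReal (w p.1.1 p.1.2 p.2 k) • Measure.dirac (p.1.1, p.1.2, p.2, k)) hL
  rw [lintegral_withDensity_eq_lintegral_mul _ hd hf, MHAAR.lintegral_bind_bind π q hM1 hf,
    MHAAR.lintegral_bind_bind π q hM2 (hd.mul hf)]
  let G : Fin N → X × X × U → ℝ≥0∞ := fun k p =>
    ∫⁻ v, f (p.1, p.2.1, Function.update v k p.2.2, k) ∂K (p.1, p.2.1)
  have hG : ∀ k, Measurable (G k) := by
    intro k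
    have hu : Measurable fun p : (X × X × U) × (Fin N → U) =>
        Function.update p.2 k p.1.2.2 :=
      (measurable_update' (a := k)).comp
        (g := fun p : (Fin N → U) × U => Function.update p.1 k p.2)
        (f := fun p : (X × X × U) × (Fin N → U) => (p.2, p.1.2.2)) (by fun_prop)
    have hF : Measurable fun p : (X × X × U) × (Fin N → U) =>
        f (p.1.1, p.1.2.1, Function.update p.2 k p.1.2.2, k) := hf.comp (by fun_prop)
    let K' : Kernel (X × X × U) (Fin N → U) := K.comap (fun p => (p.1, p.2.1)) (by fun_prop)
    exact hF.lintegral_kernel_prod_right' (κ := K')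
  have hg : Measurable fun p => ∑ k, (N : ℝ≥0∞)⁻¹ * G k p :=
    Finset.measurable_sum _ fun k _ => (hG k).const_mul _
  have hfk : ∀ x y k, Measurable fun v : Fin N → U => f (x, y, v, k) :=
    fun x y k => hf.comp (by fun_prop)
  refine Eq.trans ?_ ((hkey' _ hg).trans ?_)
  · refine lintegral_congr fun y => lintegral_congr fun x => ?_
    have : IsProbabilityMeasure ((Q (y, x)).map e) :=
      Measure.isProbabilityMeasure_map hem.aemeasurable
    have hGk : ∀ k, Measurable fun u => (N : ℝ≥0∞)⁻¹ * G k (x, y, u) :=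
      fun k => ((hG k).comp (by fun_prop)).const_mul _
    rw [lintegral_finsetSum_measure, lintegral_finsetSum _ fun k _ => hGk k]
    refine Finset.sum_congr rfl fun k _ => ?_
    have hGk' : Measurable fun u => G k (x, y, u) := (hG k).comp (by fun_prop)
    rw [lintegral_smul_measure, lintegral_map hf (by fun_prop), lintegral_const_mul _ hGk',
      MHAAR.lintegral_pi_update (fun _ => Q (x, y)) k _ (hfk x y k)]
    rfl
  · refine lintegral_congr fun x => lintegral_congr fun y => ?_
    have hρ : Measurable (r x y) := hrm.comp (g := fun p : X × X × U => r p.1 p.2.1 p.2.2)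
      (f := fun u => (x, y, u)) (by fun_prop)
    have hφ : Measurable fun p : (Fin N → U) × Fin N => f (x, y, p.1, p.2) :=
      hf.comp (by fun_prop)
    have hLxy : Measurable fun us : Fin N → U =>
        ∑ k : Fin N, ENNReal.ofReal (w x y us k) • Measure.dirac (x, y, us, k) :=
      hL.comp (measurable_prodMk_left (x := (x, y)))
    dsimp only
    rw [Measure.lintegral_bind hLxy.aemeasurable (hd.mul hf).aemeasurable]
    refine (MHAAR.lintegral_ratio_mul_sum hN (Q (x, y)) hρ (hr0 x y) hφ).trans ?_
    refine lintegral_congr fun v => ?_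
    rw [lintegral_finsetSum_measure]
    refine Finset.sum_congr rfl fun k _ => ?_
    rw [lintegral_smul_measure, lintegral_dirac' _ (hd.mul hf), hw]
    simp only [Pi.mul_apply, hrN, smul_eq_mul]
end

section
/- For every N ≥ 1 the Markov kernel P̊^N(x, dy) := (1/2)[∫_{U^N×{1,…,N}} Q₁^N(x, d(y,𝔲,k)) min{1, r̊^N(x,y,𝔲)} + ρ̊₁(x) δ_x(dy)] + (1/2)[∫_{U^N×{1,…,N}} Q₂^N(x, d(y,𝔲,k)) min{1, 1/r̊^N(y,x,𝔲)} + ρ̊₂(x) δ_x(dy)] (with the convention 1/0 := 0) satisfies detailed balance with respect to π: for every bounded measurable φ : X × X → ℝ, ∫∫ φ(x,y) π(dx) P̊^N(x,dy) = ∫∫ φ(y,x) π(dx) P̊^N(x,dy). -/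
open MeasureTheory ProbabilityTheory
open scoped ENNReal

/-- The product of finitely many Markov kernels with a common source. -/
noncomputable def productKernel {ι α : Type*} {β : ι → Type*} [Fintype ι] [MeasurableSpace α]
    [∀ i, MeasurableSpace (β i)] (κ : ∀ i, Kernel α (β i)) [∀ i, IsMarkovKernel (κ i)] :
    Kernel α (∀ i, β i) where
  toFun a := Measure.pi fun i => κ i a
  measurable' := by
    refine Measurable.measure_of_isPiSystem_of_isProbabilityMeasure
      generateFrom_pi.symm isPiSystem_pi ?_
    rintro _ ⟨s, hs, rfl⟩
    simp only [Measure.pi_pi]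
    exact Finset.measurable_prod _ fun i _ => (κ i).measurable_coe (hs i trivial)

instance {ι α : Type*} {β : ι → Type*} [Fintype ι] [MeasurableSpace α]
    [∀ i, MeasurableSpace (β i)] (κ : ∀ i, Kernel α (β i)) [∀ i, IsMarkovKernel (κ i)] :
    IsMarkovKernel (productKernel κ) :=
  ⟨fun a => inferInstanceAs (IsProbabilityMeasure (Measure.pi fun i => κ i a))⟩

lemma productKernel_apply {ι α : Type*} {β : ι → Type*} [Fintype ι] [MeasurableSpace α]
    [∀ i, MeasurableSpace (β i)] (κ : ∀ i, Kernel α (β i)) [∀ i, IsMarkovKernel (κ i)] (a : α) :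
    productKernel κ a = Measure.pi fun i => κ i a := rfl

/-- Resampling one coordinate of a product probability measure. -/
lemma lintegral_pi_update {ι : Type*} {α : ι → Type*} [Fintype ι] [DecidableEq ι]
    [∀ i, MeasurableSpace (α i)] (μ : ∀ i, Measure (α i)) [∀ i, IsProbabilityMeasure (μ i)]
    (k : ι) (ν : Measure (α k)) [IsProbabilityMeasure ν] {f : (∀ i, α i) → ℝ≥0∞}
    (hf : Measurable f) :
    ∫⁻ u, f u ∂Measure.pi (Function.update μ k ν)
      = ∫⁻ v, ∫⁻ u, f (Function.update u k v) ∂Measure.pi μ ∂ν := by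
  have hm : Measurable fun p : α k × (∀ i, α i) => Function.update p.2 k p.1 := by
    refine measurable_pi_lambda _ fun i => ?_
    by_cases h : i = k
    · subst h
      simpa using measurable_fst
    · simp only [Function.update_of_ne h]
      fun_prop
  have : ∀ i, IsProbabilityMeasure (Function.update μ k ν i) := by
    intro i
    by_cases h : i = k
    · subst h
      simpa
    · simp only [Function.update_of_ne h]
      infer_instance
  have key : Measure.pi (Function.update μ k ν)
      = (ν.prod (Measure.pi μ)).map fun p => Function.update p.2 k p.1 := by
    refine Measure.pi_eq fun s hs => ?_
    rw [Measure.map_apply hm (MeasurableSet.univ_pi hs)]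
    have : (fun p : α k × (∀ i, α i) => Function.update p.2 k p.1) ⁻¹' Set.univ.pi s
        = s k ×ˢ Set.univ.pi (Function.update s k Set.univ) := by
      ext ⟨v, u⟩
      simp only [Set.mem_preimage, Set.mem_pi, Set.mem_univ, true_imp_iff, Set.mem_prod]
      constructor
      · refine fun h => ⟨by simpa using h k, fun i => ?_⟩
        by_cases hi : i = k
        · subst hi
          simp
        · simpa [Function.update_of_ne hi] using h i
      · rintro ⟨hv, hu⟩ i
        by_cases hi : i = k
        · subst hi
          simpa
        · simpa [Function.update_of_ne hi] using hu i
    rw [this, Measure.prod_prod, Measure.pi_pi,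
      ← Finset.mul_prod_erase Finset.univ (fun i => μ i (Function.update s k Set.univ i))
        (Finset.mem_univ k),
      ← Finset.mul_prod_erase Finset.univ (fun i => Function.update μ k ν i (s i))
        (Finset.mem_univ k)]
    simp only [Function.update_self, measure_univ, one_mul]
    congr 1
    refine Finset.prod_congr rfl fun i hi => ?_
    simp [Function.update_of_ne (Finset.ne_of_mem_erase hi)]
  rw [key, lintegral_map hf hm, lintegral_prod]
  exact (hf.comp hm).aemeasurable

/-- The product kernel with `k`-th factor `P` and all the other factors equal to `R`. -/
noncomputable def resampleKernel {α U : Type*} [MeasurableSpace α] [MeasurableSpace U] (N : ℕ)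
    (P R : Kernel α U) [IsMarkovKernel P] [IsMarkovKernel R] (k : Fin N) :
    Kernel α (Fin N → U) where
  toFun a := Measure.pi (Function.update (fun _ : Fin N => R a) k (P a))
  measurable' := by
    have : ∀ i, IsMarkovKernel (Function.update (fun _ : Fin N => R) k P i) := by
      intro i
      by_cases h : i = k
      · subst h
        simpa
      · simpa only [Function.update_of_ne h]
    have h := (productKernel (Function.update (fun _ : Fin N => R) k P)).measurable
    convert h using 2 with a
    rw [productKernel_apply]
    congr 1 with i : 1
    by_cases h : i = k
    · subst h
      simp
    · simp only [Function.update_of_ne h]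

lemma resampleKernel_apply {α U : Type*} [MeasurableSpace α] [MeasurableSpace U] (N : ℕ)
    (P R : Kernel α U) [IsMarkovKernel P] [IsMarkovKernel R] (k : Fin N) (a : α) :
    resampleKernel N P R k a
      = Measure.pi (Function.update (fun _ : Fin N => R a) k (P a)) := rfl

instance {α U : Type*} [MeasurableSpace α] [MeasurableSpace U] (N : ℕ)
    (P R : Kernel α U) [IsMarkovKernel P] [IsMarkovKernel R] (k : Fin N) :
    IsMarkovKernel (resampleKernel N P R k) := by
  refine ⟨fun a => ?_⟩
  have : ∀ i, IsProbabilityMeasure (Function.update (fun _ : Fin N => R a) k (P a) i) := by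
    intro i
    by_cases h : i = k
    · subst h
      simp only [Function.update_self]
      infer_instance
    · simp only [Function.update_of_ne h]
      infer_instance
  rw [resampleKernel_apply]
  infer_instance

/-- The law of the auxiliary variables under the second proposal mechanism: a uniformly chosen
coordinate is drawn from `P`, all the others from `R`. -/
noncomputable def mixtureKernel {α U : Type*} [MeasurableSpace α] [MeasurableSpace U] (N : ℕ)
    (P R : Kernel α U) [IsMarkovKernel P] [IsMarkovKernel R] : Kernel α (Fin N → U) where
  toFun a := ∑ k : Fin N, (N : ℝ≥0∞)⁻¹ • resampleKernel N P R k a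
  measurable' := by
    refine Measure.measurable_of_measurable_coe _ fun s hs => ?_
    simp only [Measure.finsetSum_apply, Measure.smul_apply, smul_eq_mul]
    exact Finset.measurable_sum _ fun k _ => (Kernel.measurable_coe _ hs).const_mul _

lemma mixtureKernel_apply {α U : Type*} [MeasurableSpace α] [MeasurableSpace U] (N : ℕ)
    (P R : Kernel α U) [IsMarkovKernel P] [IsMarkovKernel R] (a : α) :
    mixtureKernel N P R a = ∑ k : Fin N, (N : ℝ≥0∞)⁻¹ • resampleKernel N P R k a := rfl

instance {α U : Type*} [MeasurableSpace α] [MeasurableSpace U] (N : ℕ) [NeZero N]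
    (P R : Kernel α U) [IsMarkovKernel P] [IsMarkovKernel R] :
    IsMarkovKernel (mixtureKernel N P R) := by
  refine ⟨fun a => ⟨?_⟩⟩
  simp only [mixtureKernel_apply, Measure.finsetSum_apply, Measure.smul_apply, measure_univ,
    smul_eq_mul, mul_one, Finset.sum_const, Finset.card_univ, Fintype.card_fin, nsmul_eq_mul]
  exact ENNReal.mul_inv_cancel (by simp [NeZero.ne N]) (by simp)

section AcceptanceRatio

variable {X V : Type*} [MeasurableSpace X] [MeasurableSpace V]

/-- Tonelli for an iterated `Measure.bind` of kernels. -/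
lemma bind_bind_map_eq_map_compProd {Z : Type*} [MeasurableSpace Z] (π : Measure X) [SFinite π]
    (q : Kernel X X) [IsSFiniteKernel q] (K : Kernel (X × X) V) [IsSFiniteKernel K]
    {g : X × X × V → Z} (hg : Measurable g) :
    π.bind (fun x => (q x).bind fun y => (K (x, y)).map fun v => g (x, y, v))
      = (π ⊗ₘ (q ⊗ₖ K)).map g := by
  have hinner : Measurable fun p : X × X => (K p).map fun v => g (p.1, p.2, v) := by
    refine Measure.measurable_of_measurable_coe _ fun s hs => ?_
    have (p : X × X) : ((K p).map fun v => g (p.1, p.2, v)) s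
        = K p (Prod.mk p ⁻¹' ((fun z : (X × X) × V => g (z.1.1, z.1.2, z.2)) ⁻¹' s)) := by
      rw [Measure.map_apply (by fun_prop) hs]
      rfl
    simp only [this]
    exact Kernel.measurable_kernel_prodMk_left (hs.preimage (by fun_prop))
  have hslice (x : X) : Measurable fun y => (K (x, y)).map fun v => g (x, y, v) :=
    hinner.comp measurable_prodMk_left
  have houter : Measurable fun x => (q x).bind fun y => (K (x, y)).map fun v => g (x, y, v) := by
    refine Measure.measurable_of_measurable_coe _ fun s hs => ?_
    simp only [fun x => Measure.bind_apply hs (hslice x).aemeasurable (m := q x)]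
    exact Measurable.lintegral_kernel_prod_right
      (f := fun x y => ((K (x, y)).map fun v => g (x, y, v)) s)
      ((Measure.measurable_coe hs).comp hinner)
  refine Measure.ext_of_lintegral _ fun f hf => ?_
  rw [Measure.lintegral_bind houter.aemeasurable hf.aemeasurable, lintegral_map hf hg,
    Measure.lintegral_compProd (f := fun z => f (g z)) (hf.comp hg)]
  refine lintegral_congr fun x => ?_
  rw [Measure.lintegral_bind (hslice x).aemeasurable hf.aemeasurable,
    Kernel.lintegral_compProd _ _ _ (by fun_prop)]
  refine lintegral_congr fun y => ?_
  rw [lintegral_map hf (by fun_prop)]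

/-- Forgetting an index that is drawn from normalised weights. -/
lemma map_bind_bind_sum_dirac {ι : Type*} [Fintype ι] [MeasurableSpace ι] (q : Kernel X X)
    [IsSFiniteKernel q] (K : Kernel (X × X) V) [IsSFiniteKernel K] (x : X)
    (w : X → V → ι → ℝ≥0∞) (hw : ∀ k, Measurable fun p : X × V => w p.1 p.2 k)
    (hw1 : ∀ y v, ∑ k, w y v k = 1) :
    ((q x).bind fun y => (K (x, y)).bind fun v =>
        ∑ k, w y v k • Measure.dirac (y, v, k)).map (fun t => (t.1, t.2.1)) = (q ⊗ₖ K) x := by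
  have hG : Measurable fun p : X × V => ∑ k, w p.1 p.2 k • Measure.dirac (p.1, p.2, k) := by
    refine Measure.measurable_of_measurable_coe _ fun s hs => ?_
    simp only [Measure.finsetSum_apply, Measure.smul_apply, smul_eq_mul]
    exact Finset.measurable_sum _ fun k _ => (hw k).mul
      ((Measure.measurable_coe hs).comp (Measure.measurable_dirac.comp (by fun_prop)))
  have hslice (y : X) : Measurable fun v => ∑ k, w y v k • Measure.dirac (y, v, k) :=
    hG.comp measurable_prodMk_left
  have houter : Measurable fun y => (K (x, y)).bind fun v =>
      ∑ k, w y v k • Measure.dirac (y, v, k) := by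
    refine Measure.measurable_of_measurable_coe _ fun s hs => ?_
    simp only [fun y => Measure.bind_apply hs (hslice y).aemeasurable (m := K (x, y))]
    exact Measurable.lintegral_kernel_prod_right
      (κ := K.comap (Prod.mk x) measurable_prodMk_left)
      (f := fun y v => (∑ k, w y v k • Measure.dirac (y, v, k)) s)
      ((Measure.measurable_coe hs).comp hG)
  refine Measure.ext_of_lintegral _ fun f hf => ?_
  have hf' : Measurable fun t : X × V × ι => f (t.1, t.2.1) := by fun_prop
  rw [lintegral_map hf (by fun_prop), Kernel.lintegral_compProd _ _ _ hf,
    Measure.lintegral_bind houter.aemeasurable hf'.aemeasurable]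
  refine lintegral_congr fun y => ?_
  rw [Measure.lintegral_bind (hslice y).aemeasurable hf'.aemeasurable]
  refine lintegral_congr fun v => ?_
  simp only [lintegral_finsetSum_measure, lintegral_smul_measure, lintegral_dirac' _ hf',
    smul_eq_mul, ← Finset.sum_mul, hw1, one_mul]

/-- Forgetting the index of a mixture of kernels. -/
lemma map_bind_sum_map {ι : Type*} [Fintype ι] [MeasurableSpace ι] (q : Kernel X X)
    [IsSFiniteKernel q] (K : Kernel (X × X) V) [IsSFiniteKernel K] (x : X)
    (L : ι → Kernel (X × X) V) [∀ k, IsSFiniteKernel (L k)] (c : ℝ≥0∞)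
    (hL : ∀ y, K (x, y) = ∑ k, c • L k (x, y)) :
    ((q x).bind fun y => ∑ k, c • (L k (x, y)).map fun v => (y, v, k)).map
      (fun t => (t.1, t.2.1)) = (q ⊗ₖ K) x := by
  have hm : Measurable fun y => ∑ k, c • (L k (x, y)).map fun v => (y, v, k) := by
    refine Measure.measurable_of_measurable_coe _ fun s hs => ?_
    simp only [Measure.finsetSum_apply, Measure.smul_apply, smul_eq_mul]
    refine Finset.measurable_sum _ fun k _ => Measurable.const_mul ?_ _
    have (y : X) : ((L k (x, y)).map fun v => (y, v, k)) s
        = (L k).comap (Prod.mk x) measurable_prodMk_left y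
          (Prod.mk y ⁻¹' ((fun z : X × V => (z.1, z.2, k)) ⁻¹' s)) := by
      rw [Measure.map_apply (by fun_prop) hs]
      rfl
    simp only [this]
    exact Kernel.measurable_kernel_prodMk_left (hs.preimage (by fun_prop))
  refine Measure.ext_of_lintegral _ fun f hf => ?_
  have hf' : Measurable fun t : X × V × ι => f (t.1, t.2.1) := by fun_prop
  rw [lintegral_map hf (by fun_prop), Kernel.lintegral_compProd _ _ _ hf,
    Measure.lintegral_bind hm.aemeasurable hf'.aemeasurable]
  refine lintegral_congr fun y => ?_
  simp only [hL, lintegral_finsetSum_measure, lintegral_smul_measure]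
  refine Finset.sum_congr rfl fun k _ => ?_
  rw [lintegral_map hf' (by fun_prop)]

lemma integrable_integral_compProd {Y : Type*} [MeasurableSpace Y] (π : Measure X) [SFinite π]
    (κ : Kernel X Y) [IsSFiniteKernel κ] {f : X × Y → ℝ} (hf : Integrable f (π ⊗ₘ κ)) :
    Integrable (fun x => ∫ y, f (x, y) ∂κ x) π := by
  simpa using Integrable.integral_compProd (κ := Kernel.const Unit π)
    (η := Kernel.prodMkLeft Unit κ) (a := ()) hf

/-- The accept-reject identity behind the two Metropolis-Hastings moves. -/
lemma integral_min_inv_eq_integral_min (π : Measure X) [IsProbabilityMeasure π]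
    (κ₁ κ₂ : Kernel X (X × V)) [IsMarkovKernel κ₁] [IsMarkovKernel κ₂]
    (ρ : X × X × V → ℝ) (hρ : Measurable ρ) (hρ0 : ∀ z, 0 ≤ ρ z)
    (h : (π ⊗ₘ κ₂).map (fun z => (z.2.1, z.1, z.2.2))
      = (π ⊗ₘ κ₁).withDensity fun z => ENNReal.ofReal (ρ z))
    (φ : X → X → ℝ) (hφ : Measurable (Function.uncurry φ)) :
    ∫ z, min 1 (ρ (z.2.1, z.1, z.2.2))⁻¹ * φ z.1 z.2.1 ∂(π ⊗ₘ κ₂)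
      = ∫ z, min 1 (ρ z) * φ z.2.1 z.1 ∂(π ⊗ₘ κ₁) := by
  have hφ' : Measurable fun z : X × X × V => φ z.2.1 z.1 :=
    hφ.comp (by fun_prop : Measurable fun z : X × X × V => (z.2.1, z.1))
  have hmap := integral_map (μ := π ⊗ₘ κ₂) (φ := fun z => (z.2.1, z.1, z.2.2))
    (f := fun z => min 1 (ρ z)⁻¹ * φ z.2.1 z.1) (by fun_prop)
    (Measurable.aestronglyMeasurable (by fun_prop))
  rw [← hmap, h, integral_withDensity_eq_integral_toReal_smul (by fun_prop) (by simp)]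
  refine integral_congr_ae (Filter.Eventually.of_forall fun z => ?_)
  simp only [ENNReal.toReal_ofReal (hρ0 z), smul_eq_mul, ← mul_assoc]
  congr 1
  rcases (hρ0 z).eq_or_lt with h0 | h0
  · simp [← h0]
  · rw [mul_min_of_nonneg _ _ h0.le, mul_one, mul_inv_cancel₀ h0.ne', min_comm]

lemma integrable_mul_of_mem_Icc (π : Measure X) [IsProbabilityMeasure π]
    (κ : Kernel X (X × V)) [IsMarkovKernel κ] (α : X × X × V → ℝ) (hα : Measurable α)
    (hα0 : ∀ z, 0 ≤ α z) (hα1 : ∀ z, α z ≤ 1) (ψ : X → X → ℝ)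
    (hψ : Measurable (Function.uncurry ψ)) (hψb : ∃ C, ∀ x y, |ψ x y| ≤ C) :
    Integrable (fun z => α z * ψ z.1 z.2.1) (π ⊗ₘ κ) := by
  obtain ⟨C, hC⟩ := hψb
  have hψ' : Measurable fun z : X × X × V => ψ z.1 z.2.1 :=
    hψ.comp (by fun_prop : Measurable fun z : X × X × V => (z.1, z.2.1))
  refine Integrable.of_bound (C := C) (Measurable.aestronglyMeasurable (by fun_prop))
    (Filter.Eventually.of_forall fun z => ?_)
  rw [Real.norm_eq_abs, abs_mul, abs_of_nonneg (hα0 z)]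
  exact (mul_le_of_le_one_left (abs_nonneg _) (hα1 z)).trans (hC _ _)

/-- The integral of a test function against a half-and-half mixture of two accept-reject
mechanisms, split into moves and a term that only sees the diagonal. -/
lemma integral_acceptReject (π : Measure X) [IsProbabilityMeasure π]
    (κ₁ κ₂ : Kernel X (X × V)) [IsMarkovKernel κ₁] [IsMarkovKernel κ₂]
    (α₁ α₂ : X × X × V → ℝ) (hα₁ : Measurable α₁) (hα₂ : Measurable α₂)
    (h₁0 : ∀ z, 0 ≤ α₁ z) (h₁1 : ∀ z, α₁ z ≤ 1) (h₂0 : ∀ z, 0 ≤ α₂ z) (h₂1 : ∀ z, α₂ z ≤ 1)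
    (φ : X → X → ℝ) (hφ : Measurable (Function.uncurry φ)) (hφb : ∃ C, ∀ x y, |φ x y| ≤ C) :
    ∫ x, ((1/2) * ((∫ t, α₁ (x, t) * φ x t.1 ∂κ₁ x) + (1 - ∫ t, α₁ (x, t) ∂κ₁ x) * φ x x)
        + (1/2) * ((∫ t, α₂ (x, t) * φ x t.1 ∂κ₂ x) + (1 - ∫ t, α₂ (x, t) ∂κ₂ x) * φ x x)) ∂π
      = (1/2) * ((∫ z, α₁ z * φ z.1 z.2.1 ∂(π ⊗ₘ κ₁)) + ∫ z, α₂ z * φ z.1 z.2.1 ∂(π ⊗ₘ κ₂))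
        + ∫ x, ((1/2) * ((1 - ∫ t, α₁ (x, t) ∂κ₁ x) * φ x x)
          + (1/2) * ((1 - ∫ t, α₂ (x, t) ∂κ₂ x) * φ x x)) ∂π := by
  have hdiag : Measurable fun x => φ x x :=
    hφ.comp (by fun_prop : Measurable fun x : X => (x, x))
  have hrej (κ : Kernel X (X × V)) [IsMarkovKernel κ] (α : X × X × V → ℝ) (hα : Measurable α)
      (h0 : ∀ z, 0 ≤ α z) (h1 : ∀ z, α z ≤ 1) :
      Integrable (fun x => (1 - ∫ t, α (x, t) ∂κ x) * φ x x) π := by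
    have hd := integrable_integral_compProd _ _ (integrable_mul_of_mem_Icc π κ α hα h0 h1
      (fun x _ => φ x x) (hdiag.comp measurable_fst) (hφb.imp fun C hC x _ => hC x x))
    have hφd : Integrable (fun x => φ x x) π := by
      obtain ⟨C, hC⟩ := hφb
      exact Integrable.of_bound (C := C) hdiag.aestronglyMeasurable
        (Filter.Eventually.of_forall fun x => hC x x)
    refine (hφd.sub hd).congr (Filter.Eventually.of_forall fun x => ?_)
    simp only [Pi.sub_apply, integral_mul_const]
    ring
  have i₁ := integrable_mul_of_mem_Icc π κ₁ α₁ hα₁ h₁0 h₁1 φ hφ hφb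
  have i₂ := integrable_mul_of_mem_Icc π κ₂ α₂ hα₂ h₂0 h₂1 φ hφ hφb
  have m₁ := integrable_integral_compProd _ _ i₁
  have m₂ := integrable_integral_compProd _ _ i₂
  have r₁ := hrej κ₁ α₁ hα₁ h₁0 h₁1
  have r₂ := hrej κ₂ α₂ hα₂ h₂0 h₂1
  rw [Measure.integral_compProd i₁, Measure.integral_compProd i₂, ← integral_add m₁ m₂,
    ← integral_const_mul]
  refine Eq.trans ?_ (integral_add ((m₁.add m₂).const_mul _)
    ((r₁.const_mul _).add (r₂.const_mul _)))
  refine integral_congr_ae (Filter.Eventually.of_forall fun x => ?_)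
  ring

end AcceptanceRatio

/-- Averaging over `N` auxiliary variables turns the reversal density `r` of the one-sample
proposal into the empirical mean of `r`. -/
lemma map_compProd_mixtureKernel_eq_withDensity {X U : Type*} [MeasurableSpace X]
    [MeasurableSpace U] (π : Measure X) [IsProbabilityMeasure π] (q : Kernel X X)
    [IsMarkovKernel q] (Q P : Kernel (X × X) U) [IsMarkovKernel Q] [IsMarkovKernel P]
    (r : X × X × U → ℝ≥0∞) (hr : Measurable r)
    (h : (π ⊗ₘ (q ⊗ₖ P)).map (fun z => (z.2.1, z.1, z.2.2)) = (π ⊗ₘ (q ⊗ₖ Q)).withDensity r)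
    (N : ℕ) [NeZero N] :
    (π ⊗ₘ (q ⊗ₖ mixtureKernel N P (Q.comap Prod.swap measurable_swap))).map
        (fun z => (z.2.1, z.1, z.2.2))
      = (π ⊗ₘ (q ⊗ₖ productKernel fun _ : Fin N => Q)).withDensity
        fun z => (N : ℝ≥0∞)⁻¹ * ∑ k, r (z.1, z.2.1, z.2.2 k) := by
  have hswap : ∀ F : X × X × U → ℝ≥0∞, Measurable F →
      ∫⁻ y, ∫⁻ x, ∫⁻ v, F (x, y, v) ∂P (y, x) ∂q y ∂π
        = ∫⁻ x, ∫⁻ y, ∫⁻ v, r (x, y, v) * F (x, y, v) ∂Q (x, y) ∂q x ∂π := by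
    intro F hF
    have hl := congrArg (fun μ => ∫⁻ z, F z ∂μ) h
    rw [lintegral_map hF (by fun_prop), Measure.lintegral_compProd (by fun_prop),
      lintegral_withDensity_eq_lintegral_mul _ hr hF,
      Measure.lintegral_compProd (hr.mul hF)] at hl
    convert hl using 3 with y x
    · rw [Kernel.lintegral_compProd _ _ _ (by fun_prop)]
    · rw [Kernel.lintegral_compProd _ _ _ (by fun_prop)]
      rfl
  have hupd (k : Fin N) : Measurable fun p : (X × X × U) × (Fin N → U) =>
      (p.1.1, p.1.2.1, Function.update p.2 k p.1.2.2) := by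
    refine measurable_fst.fst.prodMk (measurable_fst.snd.fst.prodMk
      (measurable_pi_lambda _ fun i => ?_))
    by_cases hi : i = k
    · subst hi
      simp only [Function.update_self]
      fun_prop
    · simp only [Function.update_of_ne hi]
      fun_prop
  refine Measure.ext_of_lintegral _ fun f hf => ?_
  have hsum : Measurable fun z : X × X × (Fin N → U) =>
      (N : ℝ≥0∞)⁻¹ * ∑ k, r (z.1, z.2.1, z.2.2 k) := by fun_prop
  set G : Fin N → X × X × U → ℝ≥0∞ := fun k z =>
    ∫⁻ u, f (z.1, z.2.1, Function.update u k z.2.2)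
      ∂productKernel (fun _ : Fin N => Q) (z.1, z.2.1) with hG
  have hGm (k : Fin N) : Measurable (G k) :=
    Measurable.lintegral_kernel_prod_right'
      (κ := (productKernel fun _ : Fin N => Q).comap (fun z : X × X × U => (z.1, z.2.1))
        (by fun_prop)) (hf.comp (hupd k))
  have hleft (x y : X) :
      ∫⁻ u, f (x, y, u) ∂mixtureKernel N P (Q.comap Prod.swap measurable_swap) (y, x)
        = ∫⁻ v, ∑ k, (N : ℝ≥0∞)⁻¹ * G k (x, y, v) ∂P (y, x) := by
    rw [lintegral_finsetSum _ fun k _ => by fun_prop, mixtureKernel_apply,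
      lintegral_finsetSum_measure]
    refine Finset.sum_congr rfl fun k _ => ?_
    rw [lintegral_smul_measure, smul_eq_mul, lintegral_const_mul _ (by fun_prop),
      resampleKernel_apply, lintegral_pi_update _ _ _ (by fun_prop)]
    rfl
  have hright (x y : X) :
      ∫⁻ v, r (x, y, v) * ∑ k, (N : ℝ≥0∞)⁻¹ * G k (x, y, v) ∂Q (x, y)
        = ∫⁻ u, ((N : ℝ≥0∞)⁻¹ * ∑ k, r (x, y, u k)) * f (x, y, u)
          ∂productKernel (fun _ : Fin N => Q) (x, y) := by
    simp only [Finset.mul_sum, Finset.sum_mul]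
    rw [lintegral_finsetSum _ fun k _ => by fun_prop, lintegral_finsetSum _ fun k _ => by fun_prop]
    refine Finset.sum_congr rfl fun k _ => ?_
    have hres := lintegral_pi_update (fun _ : Fin N => Q (x, y)) k (Q (x, y))
      (f := fun u => (N : ℝ≥0∞)⁻¹ * r (x, y, u k) * f (x, y, u)) (by fun_prop)
    rw [Function.update_eq_self k (fun _ : Fin N => Q (x, y))] at hres
    rw [productKernel_apply, hres]
    refine lintegral_congr fun v => ?_
    simp only [Function.update_self]
    have hfm : Measurable fun u => f (x, y, Function.update u k v) :=
      hf.comp ((hupd k).comp (measurable_prodMk_left (x := (x, y, v))))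
    rw [lintegral_const_mul _ hfm]
    simp only [hG, productKernel_apply]
    ring
  rw [lintegral_map hf (by fun_prop), Measure.lintegral_compProd (by fun_prop),
    lintegral_withDensity_eq_lintegral_mul _ hsum hf, Measure.lintegral_compProd (hsum.mul hf)]
  calc _ = ∫⁻ y, ∫⁻ x, ∫⁻ v, ∑ k, (N : ℝ≥0∞)⁻¹ * G k (x, y, v) ∂P (y, x) ∂q y ∂π := by
        refine lintegral_congr fun y => ?_
        rw [Kernel.lintegral_compProd _ _ _ (by fun_prop)]
        exact lintegral_congr fun x => hleft x y
    _ = ∫⁻ x, ∫⁻ y, ∫⁻ v, r (x, y, v) * ∑ k, (N : ℝ≥0∞)⁻¹ * G k (x, y, v)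
          ∂Q (x, y) ∂q x ∂π :=
        hswap (fun z => ∑ k, (N : ℝ≥0∞)⁻¹ * G k z) (by fun_prop)
    _ = _ := by
        refine lintegral_congr fun x => ?_
        simp only [Pi.mul_apply]
        rw [Kernel.lintegral_compProd _ _ _ (by fun_prop)]
        exact lintegral_congr fun y => hright x y

/-- **Detailed balance of the MHAAR kernel with averaged acceptance ratios
(Theorem 1(1) / `thm:theoreticaljustification` of Andrieu, Doucet, Yıldırım & Chopin).**

With `π, q, Q, e, r` as in the pseudo-marginal-ratio setting
(`π(dy) q(y,dx) Q̄_{y,x}(du) = r(x,y,u) ⬝ π(dx) q(x,dy) Q_{x,y}(du)`),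
`r̊^N(x,y,us) = N⁻¹ ∑ᵢ r(x,y,u⁽ⁱ⁾)` and `Q₁^N, Q₂^N` the two proposal mechanisms of
Algorithm 1, the kernel
`P̊^N(x,dy) = (1/2)[∫ Q₁^N(x,·) min{1, r̊^N(x,y,us)} + ρ̊₁(x)δ_x]
           + (1/2)[∫ Q₂^N(x,·) min{1, 1/r̊^N(y,x,us)} + ρ̊₂(x)δ_x]`
satisfies detailed balance with respect to `π` (with the convention `1/0 = 0`). -/
theorem mhaar_averaged_detailed_balance
    {X U : Type*} [MeasurableSpace X] [MeasurableSpace U]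
    (π : Measure X) [IsProbabilityMeasure π]
    (q : Kernel X X) [IsMarkovKernel q]
    (Q : Kernel (X × X) U) [IsMarkovKernel Q]
    (e : U → U) (hem : Measurable e) (hee : ∀ u, e (e u) = u)
    (r : X → X → U → ℝ)
    (hrm : Measurable (fun p : X × X × U => r p.1 p.2.1 p.2.2))
    (hr0 : ∀ x y u, 0 ≤ r x y u)
    (hkey : π.bind (fun y => (q y).bind (fun x =>
        ((Q (y, x)).map e).map (fun u => (x, y, u))))
      = (π.bind (fun x => (q x).bind (fun y =>
          (Q (x, y)).map (fun u => (x, y, u))))).withDensity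
          (fun p => ENNReal.ofReal (r p.1 p.2.1 p.2.2)))
    (N : ℕ) (hN : 1 ≤ N)
    (w : X → X → (Fin N → U) → Fin N → ℝ)
    (hw : ∀ x y us k, w x y us k =
      if 0 < ∑ i, r x y (us i) then r x y (us k) / ∑ i, r x y (us i) else (N : ℝ)⁻¹)
    (rN : X → X → (Fin N → U) → ℝ)
    (hrN : ∀ x y us, rN x y us = (N : ℝ)⁻¹ * ∑ i, r x y (us i))
    (Q1N Q2N : X → Measure (X × (Fin N → U) × Fin N))
    (hQ1N : ∀ x, Q1N x = (q x).bind (fun y =>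
      (Measure.pi (fun _ : Fin N => Q (x, y))).bind (fun us =>
        ∑ k : Fin N, ENNReal.ofReal (w x y us k) • Measure.dirac (y, us, k))))
    (hQ2N : ∀ x, Q2N x = (q x).bind (fun y =>
      ∑ k : Fin N, ((N : ℝ≥0∞))⁻¹ •
        ((Measure.pi (fun i : Fin N =>
            if i = k then (Q (x, y)).map e else Q (y, x))).map
          (fun us => (y, us, k)))))
    (ρ1 ρ2 : X → ℝ)
    (hρ1 : ∀ x, ρ1 x = 1 - ∫ t, min 1 (rN x t.1 t.2.1) ∂(Q1N x))
    (hρ2 : ∀ x, ρ2 x = 1 - ∫ t, min 1 (rN t.1 x t.2.1)⁻¹ ∂(Q2N x))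
    (φ : X → X → ℝ) (hφ : Measurable (Function.uncurry φ))
    (hφb : ∃ C, ∀ x y, |φ x y| ≤ C) :
    ∫ x, ((1/2) * ((∫ t, min 1 (rN x t.1 t.2.1) * φ x t.1 ∂(Q1N x)) + ρ1 x * φ x x)
        + (1/2) * ((∫ t, min 1 (rN t.1 x t.2.1)⁻¹ * φ x t.1 ∂(Q2N x)) + ρ2 x * φ x x)) ∂π
  = ∫ x, ((1/2) * ((∫ t, min 1 (rN x t.1 t.2.1) * φ t.1 x ∂(Q1N x)) + ρ1 x * φ x x)
        + (1/2) * ((∫ t, min 1 (rN t.1 x t.2.1)⁻¹ * φ t.1 x ∂(Q2N x)) + ρ2 x * φ x x)) ∂π := by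
  have : NeZero N := ⟨by omega⟩
  have hN0 : (0 : ℝ) < N := by exact_mod_cast hN
  have hrm' (k : Fin N) : Measurable fun z : X × X × (Fin N → U) => r z.1 z.2.1 (z.2.2 k) :=
    hrm.comp (by fun_prop : Measurable fun z : X × X × (Fin N → U) => (z.1, z.2.1, z.2.2 k))
  have : IsMarkovKernel (Q.map e) := Kernel.IsMarkovKernel.map Q hem
  set κ₁ : Kernel X (X × (Fin N → U)) := q ⊗ₖ productKernel fun _ : Fin N => Q with hκ₁
  set κ₂ : Kernel X (X × (Fin N → U)) :=
    q ⊗ₖ mixtureKernel N (Q.map e) (Q.comap Prod.swap measurable_swap) with hκ₂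
  set ρ : X × X × (Fin N → U) → ℝ := fun z => rN z.1 z.2.1 z.2.2 with hρ
  have hρm : Measurable ρ := by
    simp only [hρ, hrN]
    fun_prop
  have hρ0 (z) : 0 ≤ ρ z := by
    simp only [hρ, hrN]
    exact mul_nonneg (by positivity) (Finset.sum_nonneg fun i _ => hr0 _ _ _)
  have hw0 (x y us k) : 0 ≤ w x y us k := by
    rw [hw]
    split_ifs with h
    · exact div_nonneg (hr0 _ _ _) h.le
    · positivity
  have hwm (x : X) (k : Fin N) :
      Measurable fun p : X × (Fin N → U) => ENNReal.ofReal (w x p.1 p.2 k) := by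
    have hrx (i : Fin N) : Measurable fun p : X × (Fin N → U) => r x p.1 (p.2 i) :=
      (hrm' i).comp measurable_prodMk_left
    have hs : Measurable fun p : X × (Fin N → U) => ∑ i, r x p.1 (p.2 i) := by fun_prop
    simp only [hw]
    exact (Measurable.ite (measurableSet_lt measurable_const hs) ((hrx k).div hs)
      measurable_const).ennreal_ofReal
  have hw1 (x y : X) (us : Fin N → U) : ∑ k, ENNReal.ofReal (w x y us k) = 1 := by
    rw [← ENNReal.ofReal_sum_of_nonneg fun k _ => hw0 x y us k, ENNReal.ofReal_eq_one]
    simp only [hw]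
    split_ifs with h
    · rw [← Finset.sum_div, div_self h.ne']
    · simp [hN0.ne']
  have hQ₁ (x : X) : (Q1N x).map (fun t => (t.1, t.2.1)) = κ₁ x := by
    rw [hQ1N]
    exact map_bind_bind_sum_dirac q (productKernel fun _ : Fin N => Q) x
      (fun y us k => ENNReal.ofReal (w x y us k)) (hwm x) (hw1 x)
  have hQ₂ (x : X) : (Q2N x).map (fun t => (t.1, t.2.1)) = κ₂ x := by
    have hpi (y : X) (k : Fin N) :
        Measure.pi (fun i : Fin N => if i = k then (Q (x, y)).map e else Q (y, x))
          = resampleKernel N (Q.map e) (Q.comap Prod.swap measurable_swap) k (x, y) := by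
      rw [resampleKernel_apply]
      congr 1 with i : 1
      simp [Function.update_apply, Kernel.map_apply _ hem]
    simp only [hQ2N, hpi]
    exact map_bind_sum_map q _ x _ _ fun y => mixtureKernel_apply ..
  have hI₁ (x : X) (g : X × (Fin N → U) → ℝ) (hg : Measurable g) :
      ∫ t, g (t.1, t.2.1) ∂Q1N x = ∫ t, g t ∂κ₁ x := by
    rw [← hQ₁, integral_map (by fun_prop) hg.aestronglyMeasurable]
  have hI₂ (x : X) (g : X × (Fin N → U) → ℝ) (hg : Measurable g) :
      ∫ t, g (t.1, t.2.1) ∂Q2N x = ∫ t, g t ∂κ₂ x := by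
    rw [← hQ₂, integral_map (by fun_prop) hg.aestronglyMeasurable]
  have hrev : (π ⊗ₘ κ₂).map (fun z => (z.2.1, z.1, z.2.2))
      = (π ⊗ₘ κ₁).withDensity fun z => ENNReal.ofReal (ρ z) := by
    have hone : (π ⊗ₘ (q ⊗ₖ Q.map e)).map (fun z => (z.2.1, z.1, z.2.2))
        = (π ⊗ₘ (q ⊗ₖ Q)).withDensity fun z => ENNReal.ofReal (r z.1 z.2.1 z.2.2) := by
      rw [← bind_bind_map_eq_map_compProd π q (Q.map e)
        (g := fun z => (z.2.1, z.1, z.2.2)) (by fun_prop)]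
      have hid := bind_bind_map_eq_map_compProd π q Q (g := fun z => z) measurable_id'
      rw [Measure.map_id'] at hid
      rw [← hid]
      simpa only [Kernel.map_apply _ hem] using hkey
    rw [hκ₁, hκ₂, map_compProd_mixtureKernel_eq_withDensity π q Q (Q.map e) _
      hrm.ennreal_ofReal hone N]
    congr 1
    funext z
    simp only [hρ, hrN]
    rw [ENNReal.ofReal_mul (by positivity), ENNReal.ofReal_inv_of_pos hN0,
      ENNReal.ofReal_natCast, ENNReal.ofReal_sum_of_nonneg fun i _ => hr0 _ _ _]
  set α₁ : X × X × (Fin N → U) → ℝ := fun z => min 1 (ρ z)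
  set α₂ : X × X × (Fin N → U) → ℝ := fun z => min 1 (ρ (z.2.1, z.1, z.2.2))⁻¹
  have hα₁m : Measurable α₁ := by fun_prop
  have hα₂m : Measurable α₂ := by fun_prop
  have hsplit (ψ : X → X → ℝ) (hψ : Measurable (Function.uncurry ψ))
      (hψb : ∃ C, ∀ x y, |ψ x y| ≤ C) :
      ∫ x, ((1/2) * ((∫ t, min 1 (rN x t.1 t.2.1) * ψ x t.1 ∂(Q1N x)) + ρ1 x * ψ x x)
          + (1/2) * ((∫ t, min 1 (rN t.1 x t.2.1)⁻¹ * ψ x t.1 ∂(Q2N x)) + ρ2 x * ψ x x)) ∂π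
        = (1/2) * ((∫ z, min 1 (ρ z) * ψ z.1 z.2.1 ∂(π ⊗ₘ κ₁))
            + ∫ z, min 1 (ρ z) * ψ z.2.1 z.1 ∂(π ⊗ₘ κ₁))
          + ∫ x, ((1/2) * ((1 - ∫ t, α₁ (x, t) ∂κ₁ x) * ψ x x)
            + (1/2) * ((1 - ∫ t, α₂ (x, t) ∂κ₂ x) * ψ x x)) ∂π := by
    rw [← integral_min_inv_eq_integral_min π κ₁ κ₂ ρ hρm hρ0 hrev ψ hψ]
    refine Eq.trans ?_ (integral_acceptReject π κ₁ κ₂ α₁ α₂ hα₁m hα₂m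
      (fun z => le_min zero_le_one (hρ0 z)) (fun z => min_le_left _ _)
      (fun z => le_min zero_le_one (inv_nonneg.mpr (hρ0 _))) (fun z => min_le_left _ _) ψ hψ hψb)
    have hψx (x : X) : Measurable fun t : X × (Fin N → U) => ψ x t.1 :=
      hψ.comp (by fun_prop : Measurable fun t : X × (Fin N → U) => (x, t.1))
    refine integral_congr_ae (Filter.Eventually.of_forall fun x => ?_)
    simp only [hρ1, hρ2]
    rw [← hI₁ x (fun t => α₁ (x, t) * ψ x t.1) (by fun_prop),
      ← hI₁ x (fun t => α₁ (x, t)) (by fun_prop),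
      ← hI₂ x (fun t => α₂ (x, t) * ψ x t.1) (by fun_prop),
      ← hI₂ x (fun t => α₂ (x, t)) (by fun_prop)]
  rw [hsplit φ hφ hφb, hsplit (fun x y => φ y x) (hφ.comp measurable_swap)
    (hφb.imp fun C hC x y => hC y x), add_comm (∫ z, min 1 (ρ z) * φ z.1 z.2.1 ∂(π ⊗ₘ κ₁))]
end

section
/- The sequence a_N := ∫_{U^N} min{1, N^{-1} Σ_{i=1}^N ρ(u_i)} ν^{⊗N}(d(u₁,…,u_N)) is nondecreasing in N: a_N ≤ a_{N+1} for every N ≥ 1. -/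
open MeasureTheory ProbabilityTheory

/-- Forgetting the `i`-th coordinate preserves a product of probability measures. -/
theorem measurePreserving_removeNth_pi {U : Type*} [MeasurableSpace U]
    (ν : Measure U) [IsProbabilityMeasure ν] {N : ℕ} (i : Fin (N + 1)) :
    MeasurePreserving (fun u : Fin (N + 1) → U => i.removeNth u)
      (Measure.pi fun _ => ν) (Measure.pi fun _ => ν) :=
  measurePreserving_snd.comp (measurePreserving_piFinSuccAbove (fun _ => ν) i)

/-- Averaging the truncated leave-one-out means gives at most the truncated full mean. -/
theorem sum_min_one_mean_removeNth_le {N : ℕ} (hN : 1 ≤ N) (x : Fin (N + 1) → ℝ) :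
    ∑ i : Fin (N + 1), min 1 ((N : ℝ)⁻¹ * ∑ j, x (i.succAbove j)) ≤
      (N + 1 : ℝ) * min 1 (((N + 1 : ℕ) : ℝ)⁻¹ * ∑ i, x i) := by
  have hN' : (N : ℝ) ≠ 0 := by positivity
  rw [mul_min_of_nonneg _ _ (by positivity), le_min_iff]
  constructor
  · calc _ ≤ ∑ _i : Fin (N + 1), (1 : ℝ) := Finset.sum_le_sum fun _ _ => min_le_left _ _
      _ = (N + 1 : ℝ) * 1 := by simp
  · calc _ ≤ ∑ i : Fin (N + 1), (N : ℝ)⁻¹ * ∑ j, x (i.succAbove j) :=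
          Finset.sum_le_sum fun _ _ => min_le_right _ _
      _ = ∑ i : Fin (N + 1), (N : ℝ)⁻¹ * (∑ j, x j - x i) := by
          refine Finset.sum_congr rfl fun i _ => ?_
          rw [Fin.sum_univ_succAbove x i, add_sub_cancel_left]
      _ = ∑ j, x j := by
          rw [← Finset.mul_sum, Finset.sum_sub_distrib]
          simp only [Finset.sum_const, Finset.card_univ, Fintype.card_fin, nsmul_eq_mul]
          push_cast
          field_simp
          ring
      _ = (N + 1 : ℝ) * (((N + 1 : ℕ) : ℝ)⁻¹ * ∑ i, x i) := by
          push_cast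
          field_simp

/-- Truncated means of a nonnegative measurable function are integrable. -/
theorem integrable_min_one_mean {U : Type*} [MeasurableSpace U]
    (ν : Measure U) [IsProbabilityMeasure ν]
    {ρ : U → ℝ} (hρm : Measurable ρ) (hρ0 : ∀ u, 0 ≤ ρ u) (N : ℕ) :
    Integrable (fun u => min 1 ((N : ℝ)⁻¹ * ∑ i : Fin N, ρ (u i)))
      (Measure.pi fun _ : Fin N => ν) := by
  have hmeas : Measurable fun u : Fin N → U => min 1 ((N : ℝ)⁻¹ * ∑ i : Fin N, ρ (u i)) := by
    fun_prop
  refine Integrable.of_bound hmeas.aestronglyMeasurable 1 (.of_forall fun u => ?_)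
  have : 0 ≤ ∑ i : Fin N, ρ (u i) := Finset.sum_nonneg fun _ _ => hρ0 _
  rw [Real.norm_of_nonneg (by positivity)]
  exact min_le_left _ _

/-- **Monotonicity of averaged acceptance probabilities (convex-order argument in the
proof of Theorem 1 of Andrieu, Doucet, Yıldırım & Chopin).**

For a probability measure `ν` on `U` and a measurable `ρ : U → [0,∞)`, the quantity
`a_N = ∫ min{1, N⁻¹ ∑ᵢ ρ(uᵢ)} dν^{⊗N}` is nondecreasing in `N`: `a_N ≤ a_{N+1}` for
every `N ≥ 1`. -/
theorem averaged_acceptance_monotone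
    {U : Type*} [MeasurableSpace U]
    (ν : Measure U) [IsProbabilityMeasure ν]
    (ρ : U → ℝ) (hρm : Measurable ρ) (hρ0 : ∀ u, 0 ≤ ρ u)
    (N : ℕ) (hN : 1 ≤ N) :
    ∫ u, min 1 ((N : ℝ)⁻¹ * ∑ i : Fin N, ρ (u i))
        ∂(Measure.pi (fun _ : Fin N => ν))
      ≤ ∫ u, min 1 (((N + 1 : ℕ) : ℝ)⁻¹ * ∑ i : Fin (N + 1), ρ (u i))
          ∂(Measure.pi (fun _ : Fin (N + 1) => ν)) := by
  have hF := integrable_min_one_mean ν hρm hρ0 N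
  have hG := integrable_min_one_mean ν hρm hρ0 (N + 1)
  have hpres := measurePreserving_removeNth_pi ν (N := N)
  have hcomp (i : Fin (N + 1)) :
      ∫ u, min 1 ((N : ℝ)⁻¹ * ∑ j : Fin N, ρ (u (i.succAbove j)))
          ∂(Measure.pi fun _ : Fin (N + 1) => ν) =
        ∫ u, min 1 ((N : ℝ)⁻¹ * ∑ j : Fin N, ρ (u j)) ∂(Measure.pi fun _ : Fin N => ν) := by
    rw [← (hpres i).map_eq, integral_map (hpres i).aemeasurable
      ((hpres i).map_eq ▸ hF.aestronglyMeasurable)]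
    rfl
  have hint (i : Fin (N + 1)) :
      Integrable (fun u => min 1 ((N : ℝ)⁻¹ * ∑ j : Fin N, ρ (u (i.succAbove j))))
        (Measure.pi fun _ : Fin (N + 1) => ν) :=
    (hpres i).integrable_comp_of_integrable hF
  have hmono := integral_mono (integrable_finsetSum Finset.univ fun i _ => hint i)
    (hG.const_mul (N + 1 : ℝ)) fun u => sum_min_one_mean_removeNth_le hN fun i => ρ (u i)
  rw [integral_finsetSum _ fun i _ => hint i, integral_const_mul] at hmono
  simp only [hcomp, Finset.sum_const, Finset.card_univ, Fintype.card_fin, nsmul_eq_mul] at hmono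
  rw [Nat.cast_add_one] at hmono ⊢
  exact le_of_mul_le_mul_left hmono (by positivity : (0 : ℝ) < N + 1)
end

section
/- For every measurable f : X → ℝ, the Dirichlet form 𝔈_N(f) := (1/2) ∫_{X×X} ∫_{U^N} min{1, r̊^N(x,y,𝔲)} (f(x) − f(y))² ∏_{i=1}^N Q_{x,y}(du^{(i)}) π(dx) q(x, dy) ∈ [0,∞] is nondecreasing in N: 𝔈_N(f) ≤ 𝔈_{N+1}(f) for every N ≥ 1. -/
open MeasureTheory ProbabilityTheory
open scoped ENNReal

/-- The map deleting the `j`-th coordinate preserves product probability measures. -/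
lemma measurePreserving_comp_succAbove {U : Type*} [MeasurableSpace U] (μ : Measure U)
    [IsProbabilityMeasure μ] {N : ℕ} (j : Fin (N + 1)) :
    MeasurePreserving (fun (us : Fin (N + 1) → U) (i : Fin N) => us (j.succAbove i))
      (Measure.pi fun _ => μ) (Measure.pi fun _ => μ) :=
  measurePreserving_snd.comp (measurePreserving_piFinSuccAbove (fun _ : Fin (N + 1) => μ) j)

/-- Averaging over the `N + 1` leave-one-out means the truncation `min 1` is at most the
truncation of the full mean. -/
lemma sum_min_one_mean_succAbove_le {N : ℕ} (hN : 1 ≤ N) (a : Fin (N + 1) → ℝ) :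
    ∑ j : Fin (N + 1), min 1 ((N : ℝ)⁻¹ * ∑ i : Fin N, a (j.succAbove i))
      ≤ ((N + 1 : ℕ) : ℝ) * min 1 (((N + 1 : ℕ) : ℝ)⁻¹ * ∑ i, a i) := by
  have hN' : (N : ℝ) ≠ 0 := by positivity
  rw [mul_min_of_nonneg _ _ (by positivity), mul_inv_cancel_left₀ (by positivity)]
  refine le_min ?_ ?_
  · exact (Finset.sum_le_sum fun _ _ => min_le_left _ _).trans_eq (by simp)
  · refine (Finset.sum_le_sum fun _ _ => min_le_right _ _).trans_eq ?_
    have h (j : Fin (N + 1)) : ∑ i : Fin N, a (j.succAbove i) = ∑ i, a i - a j := by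
      rw [Fin.sum_univ_succAbove a j]; ring
    simp only [h, ← Finset.mul_sum, Finset.sum_sub_distrib, Finset.sum_const, Finset.card_univ,
      Fintype.card_fin, nsmul_eq_mul]
    push_cast
    field_simp
    ring

/-- The expected truncated mean of i.i.d. nonnegative variables is nondecreasing in the sample
size. -/
lemma lintegral_min_one_mean_le_succ {U : Type*} [MeasurableSpace U] (μ : Measure U)
    [IsProbabilityMeasure μ] {g : U → ℝ} (hg : Measurable g) (hg0 : ∀ u, 0 ≤ g u)
    {N : ℕ} (hN : 1 ≤ N) :
    ∫⁻ us, ENNReal.ofReal (min 1 ((N : ℝ)⁻¹ * ∑ i : Fin N, g (us i)))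
        ∂(Measure.pi fun _ : Fin N => μ)
      ≤ ∫⁻ us, ENNReal.ofReal (min 1 (((N + 1 : ℕ) : ℝ)⁻¹ * ∑ i : Fin (N + 1), g (us i)))
        ∂(Measure.pi fun _ : Fin (N + 1) => μ) := by
  have hm (n : ℕ) : Measurable fun us : Fin n → U =>
      ENNReal.ofReal (min 1 ((n : ℝ)⁻¹ * ∑ i, g (us i))) := by fun_prop
  have hc0 : ((N + 1 : ℕ) : ℝ≥0∞) ≠ 0 := by simp
  rw [← ENNReal.mul_le_mul_iff_right hc0 (ENNReal.natCast_ne_top _),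
    ← lintegral_const_mul _ (hm (N + 1))]
  calc
    _ = ∑ j : Fin (N + 1), ∫⁻ us : Fin (N + 1) → U,
          ENNReal.ofReal (min 1 ((N : ℝ)⁻¹ * ∑ i : Fin N, g (us (j.succAbove i))))
          ∂(Measure.pi fun _ => μ) := by
      simp only [fun j => (measurePreserving_comp_succAbove μ j).lintegral_comp (hm N),
        Finset.sum_const, Finset.card_univ, Fintype.card_fin, nsmul_eq_mul]
    _ = ∫⁻ us : Fin (N + 1) → U, ∑ j : Fin (N + 1),
          ENNReal.ofReal (min 1 ((N : ℝ)⁻¹ * ∑ i : Fin N, g (us (j.succAbove i))))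
          ∂(Measure.pi fun _ => μ) :=
      (lintegral_finsetSum _ fun j _ =>
        (hm N).comp (measurePreserving_comp_succAbove μ j).measurable).symm
    _ ≤ _ := by
      refine lintegral_mono fun us => ?_
      have h0 (j : Fin (N + 1)) :
          0 ≤ min 1 ((N : ℝ)⁻¹ * ∑ i : Fin N, g (us (j.succAbove i))) :=
        le_min zero_le_one (mul_nonneg (by positivity) (Finset.sum_nonneg fun _ _ => hg0 _))
      rw [← ENNReal.ofReal_sum_of_nonneg fun j _ => h0 j, ← ENNReal.ofReal_natCast,
        ← ENNReal.ofReal_mul (Nat.cast_nonneg _)]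
      exact ENNReal.ofReal_le_ofReal (sum_min_one_mean_succAbove_le hN fun i => g (us i))

/-- **Monotonicity of the Dirichlet forms of the MHAAR kernels
(Theorem 1(3a) / `thm:theoreticaljustification` of Andrieu, Doucet, Yıldırım & Chopin).**

With `π, q, Q, e, r` as in the pseudo-marginal-ratio setting
(`π(dy) q(y,dx) Q̄_{y,x}(du) = r(x,y,u) ⬝ π(dx) q(x,dy) Q_{x,y}(du)`) and
`r̊^N(x,y,us) = N⁻¹ ∑ᵢ r(x,y,u⁽ⁱ⁾)`, for every measurable `f : X → ℝ` the Dirichlet form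
`𝔈_N(f) = (1/2) ∫∫∫ min{1, r̊^N(x,y,us)} (f(x) - f(y))² ∏ᵢ Q_{x,y}(du⁽ⁱ⁾) π(dx) q(x,dy)`
is nondecreasing in `N`. -/
theorem mhaar_dirichlet_form_monotone
    {X U : Type*} [MeasurableSpace X] [MeasurableSpace U]
    (π : Measure X) [IsProbabilityMeasure π]
    (q : Kernel X X) [IsMarkovKernel q]
    (Q : Kernel (X × X) U) [IsMarkovKernel Q]
    (e : U → U) (hem : Measurable e) (hee : ∀ u, e (e u) = u)
    (r : X → X → U → ℝ)
    (hrm : Measurable (fun p : X × X × U => r p.1 p.2.1 p.2.2))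
    (hr0 : ∀ x y u, 0 ≤ r x y u)
    (hkey : π.bind (fun y => (q y).bind (fun x =>
        ((Q (y, x)).map e).map (fun u => (x, y, u))))
      = (π.bind (fun x => (q x).bind (fun y =>
          (Q (x, y)).map (fun u => (x, y, u))))).withDensity
          (fun p => ENNReal.ofReal (r p.1 p.2.1 p.2.2)))
    (f : X → ℝ) (hf : Measurable f)
    (N : ℕ) (hN : 1 ≤ N) :
    (1/2 : ℝ≥0∞) * ∫⁻ x, ∫⁻ y, ∫⁻ us,
        ENNReal.ofReal (min 1 ((N : ℝ)⁻¹ * ∑ i : Fin N, r x y (us i)))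
          * ENNReal.ofReal ((f x - f y) ^ 2)
        ∂(Measure.pi (fun _ : Fin N => Q (x, y))) ∂(q x) ∂π
    ≤ (1/2 : ℝ≥0∞) * ∫⁻ x, ∫⁻ y, ∫⁻ us,
        ENNReal.ofReal (min 1 (((N + 1 : ℕ) : ℝ)⁻¹ * ∑ i : Fin (N + 1), r x y (us i)))
          * ENNReal.ofReal ((f x - f y) ^ 2)
        ∂(Measure.pi (fun _ : Fin (N + 1) => Q (x, y))) ∂(q x) ∂π := by
  refine mul_le_mul_right (lintegral_mono fun x => lintegral_mono fun y => ?_) _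
  rw [lintegral_mul_const' _ _ ENNReal.ofReal_ne_top,
    lintegral_mul_const' _ _ ENNReal.ofReal_ne_top]
  have hr : Measurable (r x y) :=
    hrm.comp (measurable_const.prodMk (measurable_const.prodMk measurable_id))
  exact mul_le_mul_left (lintegral_min_one_mean_le_succ (Q (x, y)) hr (hr0 x y) hN) _
end

section
/- With dependent auxiliary variables: for every N ≥ 1, as measures on X × X × U^N × {1,…,N}: π(dy) Q₂^N(y, d(x,𝔲,k)) = r̊^N(x,y,𝔲) · π(dx) Q₁^N(x, d(y,𝔲,k)); consequently, the Markov kernel P̊^N(x, dy) := (1/2)[∫ Q₁^N(x, d(y,𝔲,k)) min{1, r̊^N(x,y,𝔲)} + ρ̊₁(x)δ_x(dy)] + (1/2)[∫ Q₂^N(x, d(y,𝔲,k)) min{1, 1/r̊^N(y,x,𝔲)} + ρ̊₂(x)δ_x(dy)] (convention 1/0 := 0, ρ̊₁, ρ̊₂ the complementary rejection probabilities) satisfies detailed balance with respect to π. -/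
open MeasureTheory ProbabilityTheory
open scoped ENNReal

section Kernel

variable {α β γ : Type*} [MeasurableSpace α] [MeasurableSpace β] [MeasurableSpace γ]

lemma measurable_kernel_bind (κ : Kernel α β) [IsSFiniteKernel κ] {f : α → β → Measure γ}
    (hf : Measurable (Function.uncurry f)) : Measurable (fun a => (κ a).bind (f a)) := by
  refine Measure.measurable_of_measurable_coe _ fun s hs => ?_
  have h : ∀ a, ((κ a).bind (f a)) s = ∫⁻ b, f a b s ∂κ a := fun a =>
    Measure.bind_apply hs (hf.of_uncurry_left).aemeasurable
  simp_rw [h]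
  exact Measurable.lintegral_kernel_prod_right ((Measure.measurable_coe hs).comp hf)

lemma measurable_kernel_map (κ : Kernel α β) [IsSFiniteKernel κ] {g : α → β → γ}
    (hg : Measurable (Function.uncurry g)) : Measurable (fun a => (κ a).map (g a)) := by
  refine Measure.measurable_of_measurable_coe _ fun s hs => ?_
  have h : ∀ a, ((κ a).map (g a)) s = κ a (g a ⁻¹' s) := fun a =>
    Measure.map_apply hg.of_uncurry_left hs
  simp_rw [h]
  exact Kernel.measurable_kernel_prodMk_left (hg hs)

lemma measurable_finset_sum_smul_measure {ι : Type*} (s : Finset ι) {c : ι → α → ℝ≥0∞}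
    {μ : ι → α → Measure β} (hc : ∀ i, Measurable (c i)) (hμ : ∀ i, Measurable (μ i)) :
    Measurable (fun a => ∑ i ∈ s, c i a • μ i a) := by
  refine Measure.measurable_of_measurable_coe _ fun t ht => ?_
  simp only [Measure.finsetSum_apply, Measure.smul_apply, smul_eq_mul]
  exact Finset.measurable_fun_sum _ fun i _ => (hc i).mul ((Measure.measurable_coe ht).comp (hμ i))

lemma bind_map_prodMk_eq_compProd_s12 (μ : Measure α) [SFinite μ] (κ : Kernel α β)
    [IsSFiniteKernel κ] {g : α → β → γ} (hg : Measurable (Function.uncurry g)) :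
    μ.bind (fun a => (κ a).map (g a)) = (μ ⊗ₘ κ).map (Function.uncurry g) := by
  ext s hs
  rw [Measure.bind_apply hs (measurable_kernel_map κ hg).aemeasurable,
    Measure.map_apply hg hs, Measure.compProd_apply (hg hs)]
  exact lintegral_congr fun a => Measure.map_apply hg.of_uncurry_left hs

lemma lintegral_bind_map (μ : Measure α) (κ : Kernel α β) [IsSFiniteKernel κ]
    {g : α → β → γ} (hg : Measurable (Function.uncurry g)) {F : γ → ℝ≥0∞} (hF : Measurable F) :
    ∫⁻ z, F z ∂(μ.bind fun a => (κ a).map (g a)) = ∫⁻ a, ∫⁻ b, F (g a b) ∂(κ a) ∂μ := by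
  rw [Measure.lintegral_bind (measurable_kernel_map κ hg).aemeasurable hF.aemeasurable]
  exact lintegral_congr fun a => lintegral_map hF hg.of_uncurry_left

end Kernel

section DetailedBalance

variable {X V : Type*} [MeasurableSpace X] [MeasurableSpace V]

lemma integrable_compProd_min_mul (π : Measure X) [IsProbabilityMeasure π]
    (K : Kernel X (X × V)) [IsMarkovKernel K] {g : X → X × V → ℝ}
    (hg : Measurable (Function.uncurry g)) (hg0 : ∀ x t, 0 ≤ g x t) {φ : X → X × V → ℝ}
    (hφ : Measurable (Function.uncurry φ)) {C : ℝ} (hC : ∀ x t, |φ x t| ≤ C) :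
    Integrable (fun p : X × X × V => min 1 (g p.1 p.2) * φ p.1 p.2) (π ⊗ₘ K) := by
  refine Integrable.of_bound (C := C)
    ((measurable_const.min hg).mul hφ).aestronglyMeasurable (.of_forall fun p => ?_)
  rw [Real.norm_eq_abs, abs_mul, abs_of_nonneg (le_min zero_le_one (hg0 _ _))]
  calc min 1 (g p.1 p.2) * |φ p.1 p.2| ≤ 1 * |φ p.1 p.2| :=
        mul_le_mul_of_nonneg_right (min_le_left _ _) (abs_nonneg _)
    _ ≤ C := by rw [one_mul]; exact hC _ _

lemma integrable_integral_kernel {π : Measure X} [SFinite π] {K : Kernel X V} [IsSFiniteKernel K]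
    {f : X × V → ℝ} (hf : Integrable f (π ⊗ₘ K)) :
    Integrable (fun x => ∫ t, f (x, t) ∂(K x)) π := by
  simpa using Integrable.integral_compProd (a := ()) (κ := Kernel.const Unit π)
    (η := Kernel.prodMkLeft Unit K) hf

/-- Accepting a proposal `K₁` with probability `min 1 h` balances accepting the reverse proposal
`K₂` with probability `min 1 h⁻¹`, when `h` is the density of the reversed joint law. -/
lemma integral_min_mul_eq_integral_min_inv_mul (π : Measure X) [IsProbabilityMeasure π]
    (K₁ K₂ : Kernel X (X × V)) [IsMarkovKernel K₁] [IsMarkovKernel K₂]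
    {h : X → X → V → ℝ} (hm : Measurable fun p : X × X × V => h p.1 p.2.1 p.2.2)
    (h0 : ∀ x y v, 0 ≤ h x y v)
    (hK : (π ⊗ₘ K₂).map (fun p => (p.2.1, p.1, p.2.2))
      = (π ⊗ₘ K₁).withDensity (fun p => ENNReal.ofReal (h p.1 p.2.1 p.2.2)))
    {φ : X → X → ℝ} (hφ : Measurable (Function.uncurry φ)) {C : ℝ} (hC : ∀ x y, |φ x y| ≤ C) :
    ∫ x, ∫ t, min 1 (h x t.1 t.2) * φ x t.1 ∂(K₁ x) ∂π
      = ∫ x, ∫ t, min 1 (h t.1 x t.2)⁻¹ * φ t.1 x ∂(K₂ x) ∂π := by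
  have hs : Measurable fun p : X × X × V => (p.2.1, p.1, p.2.2) := by fun_prop
  have hm' : Measurable fun p : X × X × V => h p.2.1 p.1 p.2.2 := hm.comp hs
  have hφ₁ : Measurable fun p : X × X × V => φ p.1 p.2.1 :=
    hφ.comp (g := Function.uncurry φ) (f := fun p : X × X × V => (p.1, p.2.1)) (by fun_prop)
  have hφ₂ : Measurable fun p : X × X × V => φ p.2.1 p.1 := hφ₁.comp hs
  rw [← Measure.integral_compProd (f := fun p : X × X × V => min 1 (h p.1 p.2.1 p.2.2) * φ p.1 p.2.1)
      (integrable_compProd_min_mul π K₁ (g := fun x t => h x t.1 t.2)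
        (φ := fun x t => φ x t.1) hm (fun _ _ => h0 _ _ _) hφ₁ fun _ _ => hC _ _),
    ← Measure.integral_compProd
      (f := fun p : X × X × V => min 1 (h p.2.1 p.1 p.2.2)⁻¹ * φ p.2.1 p.1)
      (integrable_compProd_min_mul π K₂ (g := fun x t => (h t.1 x t.2)⁻¹)
        (φ := fun x t => φ t.1 x) hm'.inv (fun _ _ => inv_nonneg.2 (h0 _ _ _)) hφ₂
        fun _ _ => hC _ _)]
  have hmap := integral_map (μ := π ⊗ₘ K₂) hs.aemeasurable
    (f := fun p : X × X × V => min 1 (h p.1 p.2.1 p.2.2)⁻¹ * φ p.1 p.2.1)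
    ((measurable_const.min hm.inv).mul hφ₁).aestronglyMeasurable
  rw [← hmap, hK, integral_withDensity_eq_integral_toReal_smul hm.ennreal_ofReal
    (.of_forall fun _ => ENNReal.ofReal_lt_top)]
  refine integral_congr_ae (.of_forall fun p => ?_)
  have hp := h0 p.1 p.2.1 p.2.2
  simp only [ENNReal.toReal_ofReal hp, smul_eq_mul, ← mul_assoc]
  rcases hp.eq_or_lt with hz | hpos
  · simp [← hz]
  · rw [mul_min_of_nonneg _ _ hp, mul_one, mul_inv_cancel₀ hpos.ne', min_comm]

/-- Detailed balance for the equal mixture of the two Metropolis--Hastings kernels with proposals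
`K₁` and `K₂` that are mutually reversed up to the density `h`. -/
lemma detailed_balance_mixture (π : Measure X) [IsProbabilityMeasure π]
    (K₁ K₂ : Kernel X (X × V)) [IsMarkovKernel K₁] [IsMarkovKernel K₂]
    {h : X → X → V → ℝ} (hm : Measurable fun p : X × X × V => h p.1 p.2.1 p.2.2)
    (h0 : ∀ x y v, 0 ≤ h x y v)
    (hK : (π ⊗ₘ K₂).map (fun p => (p.2.1, p.1, p.2.2))
      = (π ⊗ₘ K₁).withDensity (fun p => ENNReal.ofReal (h p.1 p.2.1 p.2.2)))
    {ρ₁ ρ₂ : X → ℝ} (hρ₁ : ∀ x, ρ₁ x = 1 - ∫ t, min 1 (h x t.1 t.2) ∂(K₁ x))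
    (hρ₂ : ∀ x, ρ₂ x = 1 - ∫ t, min 1 (h t.1 x t.2)⁻¹ ∂(K₂ x))
    {φ : X → X → ℝ} (hφ : Measurable (Function.uncurry φ)) {C : ℝ} (hC : ∀ x y, |φ x y| ≤ C) :
    ∫ x, ((1/2) * ((∫ t, min 1 (h x t.1 t.2) * φ x t.1 ∂(K₁ x)) + ρ₁ x * φ x x)
        + (1/2) * ((∫ t, min 1 (h t.1 x t.2)⁻¹ * φ x t.1 ∂(K₂ x)) + ρ₂ x * φ x x)) ∂π
      = ∫ x, ((1/2) * ((∫ t, min 1 (h x t.1 t.2) * φ t.1 x ∂(K₁ x)) + ρ₁ x * φ x x)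
        + (1/2) * ((∫ t, min 1 (h t.1 x t.2)⁻¹ * φ t.1 x ∂(K₂ x)) + ρ₂ x * φ x x)) ∂π := by
  have hs : Measurable fun p : X × X × V => (p.2.1, p.1, p.2.2) := by fun_prop
  have hm' : Measurable fun p : X × X × V => h p.2.1 p.1 p.2.2 := hm.comp hs
  have hφs : Measurable (Function.uncurry fun x y => φ y x) := hφ.comp measurable_swap
  have int₁ : ∀ {ψ : X → X → ℝ}, Measurable (Function.uncurry ψ) → ∀ {C : ℝ},
      (∀ x y, |ψ x y| ≤ C) →
      Integrable (fun x => ∫ t, min 1 (h x t.1 t.2) * ψ x t.1 ∂(K₁ x)) π := by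
    intro ψ hψ C hC
    have hψ₁ : Measurable fun p : X × X × V => ψ p.1 p.2.1 :=
      hψ.comp (g := Function.uncurry ψ) (f := fun p : X × X × V => (p.1, p.2.1)) (by fun_prop)
    exact integrable_integral_kernel (integrable_compProd_min_mul π K₁ (g := fun x t => h x t.1 t.2)
      (φ := fun x t => ψ x t.1) hm (fun _ _ => h0 _ _ _) hψ₁ fun _ _ => hC _ _)
  have int₂ : ∀ {ψ : X → X → ℝ}, Measurable (Function.uncurry ψ) → ∀ {C : ℝ},
      (∀ x y, |ψ x y| ≤ C) →
      Integrable (fun x => ∫ t, min 1 (h t.1 x t.2)⁻¹ * ψ x t.1 ∂(K₂ x)) π := by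
    intro ψ hψ C hC
    have hψ₁ : Measurable fun p : X × X × V => ψ p.1 p.2.1 :=
      hψ.comp (g := Function.uncurry ψ) (f := fun p : X × X × V => (p.1, p.2.1)) (by fun_prop)
    exact integrable_integral_kernel (integrable_compProd_min_mul π K₂ (g := fun x t => (h t.1 x t.2)⁻¹)
      (φ := fun x t => ψ x t.1) hm'.inv (fun _ _ => inv_nonneg.2 (h0 _ _ _)) hψ₁
      fun _ _ => hC _ _)
  have hdiag : AEStronglyMeasurable (fun x => φ x x) π :=
    (hφ.comp (g := Function.uncurry φ) (f := fun x : X => (x, x))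
      (by fun_prop)).aestronglyMeasurable
  have one : ∀ x y : X, |(fun _ _ => (1 : ℝ) : X → X → ℝ) x y| ≤ 1 := by simp
  have hR₁ : Integrable (fun x => ρ₁ x * φ x x) π := by
    refine Integrable.mul_bdd (c := C) ?_ hdiag (.of_forall fun x => hC x x)
    rw [funext hρ₁]
    simpa using! (integrable_const (1 : ℝ)).sub (int₁ (ψ := fun _ _ => 1) measurable_const one)
  have hR₂ : Integrable (fun x => ρ₂ x * φ x x) π := by
    refine Integrable.mul_bdd (c := C) ?_ hdiag (.of_forall fun x => hC x x)
    rw [funext hρ₂]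
    simpa using! (integrable_const (1 : ℝ)).sub (int₂ (ψ := fun _ _ => 1) measurable_const one)
  have hCs : ∀ x y, |φ y x| ≤ C := fun x y => hC y x
  have split : ∀ {A B : X → ℝ}, Integrable A π → Integrable B π →
      ∫ x, ((1/2) * (A x + ρ₁ x * φ x x) + (1/2) * (B x + ρ₂ x * φ x x)) ∂π
        = (1/2) * (∫ x, A x ∂π + ∫ x, ρ₁ x * φ x x ∂π)
          + (1/2) * (∫ x, B x ∂π + ∫ x, ρ₂ x * φ x x ∂π) := by
    intro A B hA hB
    have hA' : Integrable (fun x => (1/2) * (A x + ρ₁ x * φ x x)) π := (hA.add hR₁).const_mul _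
    have hB' : Integrable (fun x => (1/2) * (B x + ρ₂ x * φ x x)) π := (hB.add hR₂).const_mul _
    rw [integral_add hA' hB', integral_const_mul, integral_const_mul, integral_add hA hR₁, integral_add hB hR₂]
  rw [split (int₁ hφ hC) (int₂ hφ hC), split (int₁ hφs hCs) (int₂ hφs hCs),
    integral_min_mul_eq_integral_min_inv_mul π K₁ K₂ hm h0 hK hφ hC,
    integral_min_mul_eq_integral_min_inv_mul π K₁ K₂ hm h0 hK hφs hCs]
  ring

end DetailedBalance

/-- **MHAAR with dependent auxiliary variables (Theorem 2 /
`thm:generalisationexchangeable` of Andrieu, Doucet, Yıldırım & Chopin).**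

`X, U` are standard Borel, `π` a probability measure, `q` a Markov kernel on `X`,
`QN (x,y)` a probability measure on `U^N` all of whose marginals equal `Q (x,y)`,
`e : U → U` a measurable involution, `r` the acceptance-ratio density
(`π(dy) q(y,dx) Q̄_{y,x}(du) = r(x,y,u) ⬝ π(dx) q(x,dy) Q_{x,y}(du)`), and
`cond k` a regular conditional distribution of `QN` given the `k`-th coordinate.
Then, with `r̊^N(x,y,us) = N⁻¹ ∑ᵢ r(x,y,u⁽ⁱ⁾)` and the proposals `Q₁^N, Q₂^N` built from
`QN` and `cond`, one has `π(dy) Q₂^N(y, d(x,us,k)) = r̊^N(x,y,us) ⬝ π(dx) Q₁^N(x, d(y,us,k))`,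
and consequently the corresponding MHAAR kernel `P̊^N` satisfies detailed balance w.r.t. `π`
(convention `1/0 = 0`). -/
theorem mhaar_dependent_auxiliary
    {X U : Type*} [MeasurableSpace X] [StandardBorelSpace X]
    [MeasurableSpace U] [StandardBorelSpace U]
    (π : Measure X) [IsProbabilityMeasure π]
    (q : Kernel X X) [IsMarkovKernel q]
    (Q : Kernel (X × X) U) [IsMarkovKernel Q]
    (N : ℕ) (hN : 1 ≤ N)
    (QN : Kernel (X × X) (Fin N → U)) [IsMarkovKernel QN]
    (hmarg : ∀ x y (i : Fin N), (QN (x, y)).map (fun us => us i) = Q (x, y))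
    (e : U → U) (hem : Measurable e) (hee : ∀ u, e (e u) = u)
    (r : X → X → U → ℝ)
    (hrm : Measurable (fun p : X × X × U => r p.1 p.2.1 p.2.2))
    (hr0 : ∀ x y u, 0 ≤ r x y u)
    (hkey : π.bind (fun y => (q y).bind (fun x =>
        ((Q (y, x)).map e).map (fun u => (x, y, u))))
      = (π.bind (fun x => (q x).bind (fun y =>
          (Q (x, y)).map (fun u => (x, y, u))))).withDensity
          (fun p => ENNReal.ofReal (r p.1 p.2.1 p.2.2)))
    -- `cond k` is a regular conditional distribution, under `QN`, of the full vector
    -- given the `k`-th coordinate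
    (cond : Fin N → Kernel ((X × X) × U) (Fin N → U))
    [∀ k, IsMarkovKernel (cond k)]
    (hdis : ∀ x y (k : Fin N),
      QN (x, y) = (Q (x, y)).bind (fun u => (cond k) ((x, y), u)))
    (hconc : ∀ x y (k : Fin N), ∀ᵐ u ∂(Q (x, y)),
      ((cond k) ((x, y), u)) {us | us k ≠ u} = 0)
    (w : X → X → (Fin N → U) → Fin N → ℝ)
    (hw : ∀ x y us k, w x y us k =
      if 0 < ∑ i, r x y (us i) then r x y (us k) / ∑ i, r x y (us i) else (N : ℝ)⁻¹)
    (rN : X → X → (Fin N → U) → ℝ)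
    (hrN : ∀ x y us, rN x y us = (N : ℝ)⁻¹ * ∑ i, r x y (us i))
    (Q1N Q2N : X → Measure (X × (Fin N → U) × Fin N))
    (hQ1N : ∀ x, Q1N x = (q x).bind (fun y =>
      (QN (x, y)).bind (fun us =>
        ∑ k : Fin N, ENNReal.ofReal (w x y us k) • Measure.dirac (y, us, k))))
    (hQ2N : ∀ x, Q2N x = (q x).bind (fun y =>
      ∑ k : Fin N, ((N : ℝ≥0∞))⁻¹ •
        (((Q (x, y)).map e).bind (fun u =>
          ((cond k) ((y, x), u)).map (fun us => (y, us, k))))))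
    (ρ1 ρ2 : X → ℝ)
    (hρ1 : ∀ x, ρ1 x = 1 - ∫ t, min 1 (rN x t.1 t.2.1) ∂(Q1N x))
    (hρ2 : ∀ x, ρ2 x = 1 - ∫ t, min 1 (rN t.1 x t.2.1)⁻¹ ∂(Q2N x)) :
    -- (i) the asymmetric acceptance-ratio identity
    (π.bind (fun y => (Q2N y).map (fun t => (t.1, y, t.2.1, t.2.2)))
      = (π.bind (fun x => (Q1N x).map (fun t => (x, t.1, t.2.1, t.2.2)))).withDensity
          (fun p : X × X × (Fin N → U) × Fin N =>
            ENNReal.ofReal (rN p.1 p.2.1 p.2.2.1)))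
    -- (ii) detailed balance of the MHAAR kernel `P̊^N` with respect to `π`
    ∧ (∀ φ : X → X → ℝ, Measurable (Function.uncurry φ) → (∃ C, ∀ x y, |φ x y| ≤ C) →
        ∫ x, ((1/2) * ((∫ t, min 1 (rN x t.1 t.2.1) * φ x t.1 ∂(Q1N x)) + ρ1 x * φ x x)
            + (1/2) * ((∫ t, min 1 (rN t.1 x t.2.1)⁻¹ * φ x t.1 ∂(Q2N x))
                + ρ2 x * φ x x)) ∂π
        = ∫ x, ((1/2) * ((∫ t, min 1 (rN x t.1 t.2.1) * φ t.1 x ∂(Q1N x)) + ρ1 x * φ x x)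
            + (1/2) * ((∫ t, min 1 (rN t.1 x t.2.1)⁻¹ * φ t.1 x ∂(Q2N x))
                + ρ2 x * φ x x)) ∂π) := by
  have hN0 : (0 : ℝ) < N := by exact_mod_cast hN
  -- measurability of the building blocks
  have hrus : ∀ i : Fin N, Measurable
      fun p : (X × X) × (Fin N → U) => r p.1.1 p.1.2 (p.2 i) := fun i =>
    hrm.comp (f := fun p : (X × X) × (Fin N → U) => (p.1.1, p.1.2, p.2 i)) (by fun_prop)
  have hsum : Measurable fun p : (X × X) × (Fin N → U) => ∑ i, r p.1.1 p.1.2 (p.2 i) :=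
    Finset.measurable_fun_sum _ fun i _ => hrus i
  have hwm : ∀ k, Measurable fun p : (X × X) × (Fin N → U) => w p.1.1 p.1.2 p.2 k := by
    intro k
    simp_rw [hw]
    exact Measurable.ite (measurableSet_lt measurable_const hsum) ((hrus k).div hsum)
      measurable_const
  have hrNm : Measurable fun p : (X × X) × (Fin N → U) => rN p.1.1 p.1.2 p.2 := by
    simp_rw [hrN]
    exact hsum.const_mul _
  have hsum0 : ∀ x y (us : Fin N → U), 0 ≤ ∑ i, r x y (us i) := fun x y us =>
    Finset.sum_nonneg fun i _ => hr0 _ _ _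
  have hrN0 : ∀ x y us, 0 ≤ rN x y us := fun x y us => by
    rw [hrN]
    exact mul_nonneg (inv_nonneg.2 hN0.le) (hsum0 _ _ _)
  have hw0 : ∀ x y us k, 0 ≤ w x y us k := fun x y us k => by
    rw [hw]
    split_ifs with h
    · exact div_nonneg (hr0 _ _ _) h.le
    · exact inv_nonneg.2 hN0.le
  have hw1 : ∀ x y us, ∑ k, ENNReal.ofReal (w x y us k) = 1 := by
    intro x y us
    rw [← ENNReal.ofReal_sum_of_nonneg fun k _ => hw0 x y us k, ENNReal.ofReal_eq_one]
    simp_rw [hw]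
    split_ifs with h
    · rw [← Finset.sum_div, div_self h.ne']
    · simp [hN0.ne']
  have hwr : ∀ x y us k, ENNReal.ofReal (rN x y us) * ENNReal.ofReal (w x y us k)
      = (N : ℝ≥0∞)⁻¹ * ENNReal.ofReal (r x y (us k)) := by
    intro x y us k
    rw [← ENNReal.ofReal_natCast, ← ENNReal.ofReal_inv_of_pos hN0,
      ← ENNReal.ofReal_mul (hrN0 _ _ _), ← ENNReal.ofReal_mul (inv_nonneg.2 hN0.le), hrN, hw]
    split_ifs with h
    · rw [mul_assoc, mul_div_cancel₀ _ h.ne']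
    · have hz : ∑ i, r x y (us i) = 0 := le_antisymm (not_lt.1 h) (hsum0 x y us)
      have hk := (Finset.sum_eq_zero_iff_of_nonneg fun i _ => hr0 x y (us i)).1 hz k
        (Finset.mem_univ k)
      rw [hz, hk]
      simp
  -- the proposals as Markov kernels
  have hQe : ∀ p, (Q p).map e = (Q.map e) p := fun p => (Kernel.map_apply Q hem p).symm
  have : IsMarkovKernel (Q.map e) := Kernel.IsMarkovKernel.map Q hem
  simp_rw [hQe] at hkey hQ2N
  have hm₁ : Measurable fun a : (X × X) × (Fin N → U) =>
      ∑ k : Fin N, ENNReal.ofReal (w a.1.1 a.1.2 a.2 k) • Measure.dirac (a.1.2, a.2, k) :=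
    measurable_finset_sum_smul_measure _ (fun k => (hwm k).ennreal_ofReal) fun k =>
      Measure.measurable_dirac.comp (by fun_prop)
  have hm₁' := measurable_kernel_bind QN (f := fun (p : X × X) us =>
    ∑ k : Fin N, ENNReal.ofReal (w p.1 p.2 us k) • Measure.dirac (p.2, us, k)) hm₁
  have hm₂ : ∀ k : Fin N, Measurable fun a : (X × X) × U =>
      ((cond k) ((a.1.2, a.1.1), a.2)).map fun us => (a.1.2, us, k) := by
    intro k
    exact measurable_kernel_map
      ((cond k).comap (fun a : (X × X) × U => ((a.1.2, a.1.1), a.2)) (by fun_prop))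
      (g := fun a us => (a.1.2, us, k)) (by unfold Function.uncurry; fun_prop)
  have hm₂' : ∀ k : Fin N, Measurable fun p : X × X => ((Q.map e) p).bind fun u =>
      ((cond k) ((p.2, p.1), u)).map fun us => (p.2, us, k) := fun k =>
    measurable_kernel_bind (Q.map e) (f := fun (p : X × X) u =>
      ((cond k) ((p.2, p.1), u)).map fun us => (p.2, us, k)) (hm₂ k)
  have hm₂'' := measurable_finset_sum_smul_measure Finset.univ
    (c := fun (_ : Fin N) (_ : X × X) => (N : ℝ≥0∞)⁻¹) (fun _ => measurable_const) hm₂'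
  have hQ1m : Measurable Q1N := by
    rw [funext hQ1N]
    exact measurable_kernel_bind q (f := fun x y => (QN (x, y)).bind (fun us =>
      ∑ k : Fin N, ENNReal.ofReal (w x y us k) • Measure.dirac (y, us, k))) hm₁'
  have hQ2m : Measurable Q2N := by
    rw [funext hQ2N]
    exact measurable_kernel_bind q (f := fun x y => ∑ k : Fin N, ((N : ℝ≥0∞))⁻¹ •
      (((Q.map e) (x, y)).bind (fun u =>
        ((cond k) ((y, x), u)).map (fun us => (y, us, k))))) hm₂''
  have hl₁ : ∀ x {F : X × (Fin N → U) × Fin N → ℝ≥0∞}, Measurable F →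
      ∫⁻ t, F t ∂(Q1N x) = ∫⁻ y, ∫⁻ us, ∑ k, ENNReal.ofReal (w x y us k) * F (y, us, k)
        ∂(QN (x, y)) ∂(q x) := by
    intro x F hF
    rw [hQ1N]
    refine (Measure.lintegral_bind
      (hm₁'.comp (measurable_prodMk_left (x := x))).aemeasurable hF.aemeasurable).trans ?_
    refine lintegral_congr fun y => ?_
    refine (Measure.lintegral_bind
      (hm₁.comp (measurable_prodMk_left (x := (x, y)))).aemeasurable hF.aemeasurable).trans ?_
    refine lintegral_congr fun us => ?_
    simp [lintegral_finsetSum_measure, lintegral_smul_measure, lintegral_dirac' _ hF]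
  have hl₂ : ∀ x {F : X × (Fin N → U) × Fin N → ℝ≥0∞}, Measurable F →
      ∫⁻ t, F t ∂(Q2N x) = ∫⁻ y, ∑ k, (N : ℝ≥0∞)⁻¹ * ∫⁻ u, ∫⁻ us, F (y, us, k)
        ∂(cond k ((y, x), u)) ∂((Q.map e) (x, y)) ∂(q x) := by
    intro x F hF
    rw [hQ2N]
    refine (Measure.lintegral_bind
      (hm₂''.comp (measurable_prodMk_left (x := x))).aemeasurable hF.aemeasurable).trans ?_
    refine lintegral_congr fun y => ?_
    simp only [Function.comp_apply, lintegral_finsetSum_measure, lintegral_smul_measure, smul_eq_mul]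
    refine Finset.sum_congr rfl fun k _ => ?_
    congr 1
    refine (Measure.lintegral_bind
      ((hm₂ k).comp (measurable_prodMk_left (x := (x, y)))).aemeasurable hF.aemeasurable).trans ?_
    exact lintegral_congr fun u => lintegral_map hF (by fun_prop)
  let K₁ : Kernel X (X × (Fin N → U) × Fin N) := ⟨Q1N, hQ1m⟩
  let K₂ : Kernel X (X × (Fin N → U) × Fin N) := ⟨Q2N, hQ2m⟩
  have hK₁ : IsMarkovKernel K₁ := ⟨fun x => ⟨by
    have h := hl₁ x (F := fun _ => 1) measurable_const
    simp only [lintegral_const, one_mul, mul_one, hw1, measure_univ] at h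
    exact h⟩⟩
  have hK₂ : IsMarkovKernel K₂ := ⟨fun x => ⟨by
    have h := hl₂ x (F := fun _ => 1) measurable_const
    simp only [lintegral_const, one_mul, mul_one, measure_univ, Finset.sum_const,
      Finset.card_univ, Fintype.card_fin, nsmul_eq_mul] at h
    rw [ENNReal.mul_inv_cancel (by exact_mod_cast (Nat.one_le_iff_ne_zero.1 hN))
      (ENNReal.natCast_ne_top N)] at h
    exact h⟩⟩
  -- the asymmetric acceptance-ratio identity
  have hi : π.bind (fun y => (Q2N y).map (fun t => (t.1, y, t.2.1, t.2.2)))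
      = (π.bind (fun x => (Q1N x).map (fun t => (x, t.1, t.2.1, t.2.2)))).withDensity
          (fun p : X × X × (Fin N → U) × Fin N =>
            ENNReal.ofReal (rN p.1 p.2.1 p.2.2.1)) := by
    have hdens : Measurable fun p : X × X × (Fin N → U) × Fin N =>
        ENNReal.ofReal (rN p.1 p.2.1 p.2.2.1) :=
      (hrNm.comp (f := fun p : X × X × (Fin N → U) × Fin N => ((p.1, p.2.1), p.2.2.1))
        (by fun_prop)).ennreal_ofReal
    refine Measure.ext_of_lintegral _ fun F hF => ?_
    rw [lintegral_withDensity_eq_lintegral_mul _ hdens hF]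
    have e₁ := lintegral_bind_map π K₁ (g := fun x t => (x, t.1, t.2.1, t.2.2))
      (by unfold Function.uncurry; fun_prop) (hdens.mul hF)
    have e₂ := lintegral_bind_map π K₂ (g := fun y t => (t.1, y, t.2.1, t.2.2))
      (by unfold Function.uncurry; fun_prop) hF
    refine e₂.trans (Eq.trans ?_ e₁.symm)
    have hG : Measurable fun p : X × X × U => ∑ k, (N : ℝ≥0∞)⁻¹ *
        ∫⁻ us, F (p.1, p.2.1, us, k) ∂(cond k ((p.1, p.2.1), p.2.2)) := by
      refine Finset.measurable_fun_sum _ fun k _ => Measurable.const_mul ?_ _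
      exact Measurable.lintegral_kernel_prod_right
        (κ := (cond k).comap (fun p : X × X × U => ((p.1, p.2.1), p.2.2)) (by fun_prop))
        (f := fun p us => F (p.1, p.2.1, us, k))
        (hF.comp (f := fun a : (X × X × U) × (Fin N → U) => (a.1.1, a.1.2.1, a.2, k))
          (by fun_prop))
    have hrE : Measurable fun p : X × X × U => ENNReal.ofReal (r p.1 p.2.1 p.2.2) :=
      hrm.ennreal_ofReal
    -- both sides of `hkey` integrated
    have hkl := congrArg (fun m => ∫⁻ p, ∑ k, (N : ℝ≥0∞)⁻¹ *
        ∫⁻ us, F (p.1, p.2.1, us, k) ∂(cond k ((p.1, p.2.1), p.2.2)) ∂m) hkey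
    have ha : Measurable fun p : X × X => ((Q.map e) p).map fun u => (p.2, p.1, u) :=
      measurable_kernel_map (Q.map e) (g := fun (p : X × X) u => (p.2, p.1, u))
        (by unfold Function.uncurry; fun_prop)
    have hb : Measurable fun p : X × X => (Q p).map fun u => (p.1, p.2, u) :=
      measurable_kernel_map Q (g := fun (p : X × X) u => (p.1, p.2, u))
        (by unfold Function.uncurry; fun_prop)
    have ha' := measurable_kernel_bind q (f := fun y x => ((Q.map e) (y, x)).map fun u => (x, y, u)) ha
    have hb' := measurable_kernel_bind q (f := fun x y => (Q (x, y)).map fun u => (x, y, u)) hb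
    have il : ∀ {H : X × X × U → ℝ≥0∞}, Measurable H →
        ∫⁻ p, H p ∂(π.bind fun y => (q y).bind fun x =>
          ((Q.map e) (y, x)).map fun u => (x, y, u))
        = ∫⁻ y, ∫⁻ x, ∫⁻ u, H (x, y, u) ∂((Q.map e) (y, x)) ∂(q y) ∂π := by
      intro H hH
      rw [Measure.lintegral_bind ha'.aemeasurable hH.aemeasurable]
      refine lintegral_congr fun y => ?_
      refine (Measure.lintegral_bind (ha.comp (measurable_prodMk_left (x := y))).aemeasurable
        hH.aemeasurable).trans ?_
      exact lintegral_congr fun x => lintegral_map hH (by fun_prop)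
    have ir : ∀ {H : X × X × U → ℝ≥0∞}, Measurable H →
        ∫⁻ p, H p ∂(π.bind fun x => (q x).bind fun y => (Q (x, y)).map fun u => (x, y, u))
        = ∫⁻ x, ∫⁻ y, ∫⁻ u, H (x, y, u) ∂(Q (x, y)) ∂(q x) ∂π := by
      intro H hH
      rw [Measure.lintegral_bind hb'.aemeasurable hH.aemeasurable]
      refine lintegral_congr fun x => ?_
      refine (Measure.lintegral_bind (hb.comp (measurable_prodMk_left (x := x))).aemeasurable
        hH.aemeasurable).trans ?_
      exact lintegral_congr fun y => lintegral_map hH (by fun_prop)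
    rw [lintegral_withDensity_eq_lintegral_mul _ hrE hG, il hG, ir (hrE.mul hG)] at hkl
    have hFc : ∀ (x y : X) (k : Fin N), Measurable fun us : Fin N → U => F (x, y, us, k) :=
      fun x y k => hF.comp (by fun_prop)
    have hin : ∀ (x y : X) (k : Fin N),
        Measurable fun u => ∫⁻ us, F (x, y, us, k) ∂(cond k ((x, y), u)) := fun x y k =>
      Measurable.lintegral_kernel_prod_right
        (κ := (cond k).comap (fun u : U => ((x, y), u)) (by fun_prop))
        (f := fun _ us => F (x, y, us, k)) ((hFc x y k).comp measurable_snd)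
    have hru : ∀ x y : X, Measurable fun u => ENNReal.ofReal (r x y u) := fun x y =>
      hrE.comp (f := fun u : U => (x, y, u)) (by fun_prop)
    refine Eq.trans (lintegral_congr fun y => ?_) (hkl.trans (lintegral_congr fun x => ?_))
    · refine (hl₂ y (hF.comp (f := fun b : X × (Fin N → U) × Fin N => (b.1, y, b.2.1, b.2.2))
        (by fun_prop))).trans ?_
      refine lintegral_congr fun x => ?_
      rw [lintegral_finsetSum _ fun k _ => (hin x y k).const_mul _]
      exact Finset.sum_congr rfl fun k _ => (lintegral_const_mul _ (hin x y k)).symm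
    · refine Eq.trans ?_ (hl₁ x ((hdens.mul hF).comp
        (f := fun b : X × (Fin N → U) × Fin N => (x, b.1, b.2.1, b.2.2)) (by fun_prop))).symm
      refine lintegral_congr fun y => ?_
      have hrF : ∀ k, Measurable fun us : Fin N → U =>
          ENNReal.ofReal (r x y (us k)) * F (x, y, us, k) := fun k =>
        ((hru x y).comp (measurable_pi_apply k)).mul (hFc x y k)
      have hleft : ∀ u, ((fun p : X × X × U => ENNReal.ofReal (r p.1 p.2.1 p.2.2)) *
          fun p : X × X × U => ∑ k, (N : ℝ≥0∞)⁻¹ *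
            ∫⁻ us, F (p.1, p.2.1, us, k) ∂(cond k ((p.1, p.2.1), p.2.2))) (x, y, u)
          = ∑ k, (N : ℝ≥0∞)⁻¹ *
            ∫⁻ us, ENNReal.ofReal (r x y u) * F (x, y, us, k) ∂(cond k ((x, y), u)) := by
        intro u
        simp only [Pi.mul_apply, Finset.mul_sum]
        refine Finset.sum_congr rfl fun k _ => ?_
        rw [lintegral_const_mul _ (hFc x y k), mul_left_comm]
      have hright : ∀ us : Fin N → U, ∑ k, ENNReal.ofReal (w x y us k) *
          ((fun p : X × X × (Fin N → U) × Fin N => ENNReal.ofReal (rN p.1 p.2.1 p.2.2.1)) * F)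
            (x, y, us, k)
          = ∑ k, (N : ℝ≥0∞)⁻¹ * (ENNReal.ofReal (r x y (us k)) * F (x, y, us, k)) := by
        intro us
        refine Finset.sum_congr rfl fun k _ => ?_
        rw [Pi.mul_apply, ← mul_assoc, ← mul_assoc, ← hwr, mul_comm (ENNReal.ofReal (w x y us k))]
      have hin' : ∀ k, Measurable fun u =>
          ∫⁻ us, ENNReal.ofReal (r x y u) * F (x, y, us, k) ∂(cond k ((x, y), u)) := by
        intro k
        simp_rw [lintegral_const_mul _ (hFc x y k)]
        exact (hru x y).mul (hin x y k)
      refine (lintegral_congr hleft).trans (Eq.trans ?_ (lintegral_congr hright).symm)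
      rw [lintegral_finsetSum _ fun k _ => (hin' k).const_mul _,
        lintegral_finsetSum _ fun k _ => (hrF k).const_mul _]
      refine Finset.sum_congr rfl fun k _ => ?_
      rw [lintegral_const_mul _ (hin' k), lintegral_const_mul _ (hrF k)]
      congr 1
      rw [hdis x y k]
      refine Eq.trans ?_ (Measure.lintegral_bind
        ((cond k).measurable.comp (measurable_prodMk_left (x := (x, y)))).aemeasurable
        (hrF k).aemeasurable).symm
      refine lintegral_congr_ae ((hconc x y k).mono fun u hu => ?_)
      have hu' : ∀ᵐ us ∂(cond k ((x, y), u)), us k = u := hu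
      exact lintegral_congr_ae (hu'.mono fun us hus => by simp only [hus])
  refine ⟨hi, fun φ hφ ⟨C, hC⟩ => ?_⟩
  refine detailed_balance_mixture π K₁ K₂ (h := fun x y v => rN x y v.1)
    (hrNm.comp (f := fun p : X × X × (Fin N → U) × Fin N => ((p.1, p.2.1), p.2.2.1))
      (by fun_prop)) (fun _ _ _ => hrN0 _ _ _) ?_ hρ1 hρ2 hφ hC
  have b₁ := bind_map_prodMk_eq_compProd_s12 π K₁ (g := fun x t => (x, t.1, t.2.1, t.2.2))
    (by unfold Function.uncurry; fun_prop)
  have b₂ := bind_map_prodMk_eq_compProd_s12 π K₂ (g := fun y t => (t.1, y, t.2.1, t.2.2))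
    (by unfold Function.uncurry; fun_prop)
  have b₁' : (π ⊗ₘ K₁).map (Function.uncurry fun x t => (x, t.1, t.2.1, t.2.2)) = π ⊗ₘ K₁ :=
    Measure.map_id
  rw [b₁'] at b₁
  exact b₂.symm.trans (hi.trans (congrArg (fun m => m.withDensity
    fun p => ENNReal.ofReal (rN p.1 p.2.1 p.2.2.1)) b₁))
end

section
/- The Markov kernel P̆(x, dy) := Σ_{i=1}^m Σ_{j=1}^m β_{ij}(x)[∫_U Q_{ij}(x, d(y,u)) min{1, r_{ij,u}(x,y)} + ρ_{ij}(x) δ_x(dy)] satisfies detailed balance with respect to π: for every bounded measurable φ : X × X → ℝ, ∫∫ φ(x,y) π(dx) P̆(x,dy) = ∫∫ φ(y,x) π(dx) P̆(x,dy). -/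
open MeasureTheory ProbabilityTheory
open scoped ENNReal

section

variable {X U : Type*} [MeasurableSpace X] [MeasurableSpace U]

/-- If `M` and `M'` have densities `f` and `g` with respect to `M + s_* M'` and its image under the
involution `s`, then accepting with the Metropolis probability makes `s` exchange `M` and `M'`. -/
lemma integral_accept_eq_integral_accept_comp_involution {Ω : Type*} [MeasurableSpace Ω]
    {M M' : Measure Ω} {s : Ω → Ω} (hs : Measurable s) (hss : Function.Involutive s)
    {f g a b F : Ω → ℝ} (hf : Measurable f) (hg : Measurable g)
    (hf0 : ∀ p, 0 ≤ f p) (hg0 : ∀ p, 0 ≤ g p)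
    (hM : M = (M + M'.map s).withDensity (fun p => ENNReal.ofReal (f p)))
    (hM' : M' = (M' + M.map s).withDensity (fun p => ENNReal.ofReal (g p)))
    (ha : ∀ p, a p = if 0 < f p ∧ 0 < g (s p) then g (s p) / f p else 0)
    (hb : ∀ p, b p = if 0 < g p ∧ 0 < f (s p) then f (s p) / g p else 0)
    (hF : Measurable F) :
    ∫ p, min 1 (a p) * F p ∂M = ∫ p, min 1 (b p) * F (s p) ∂M' := by
  have accept : ∀ x y : ℝ, 0 ≤ x → 0 ≤ y →
      x * min 1 (if 0 < x ∧ 0 < y then y / x else 0) = min x y := by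
    intro x y hx hy
    split_ifs with h
    · rw [mul_min_of_nonneg _ _ hx, mul_one, mul_div_cancel₀ _ h.1.ne']
    · rcases hx.eq_or_lt with rfl | hx'
      · simp [hy]
      · have : y = 0 := le_antisymm (not_lt.1 fun h' => h ⟨hx', h'⟩) hy
        simp [this, hx]
  have hν : M' + M.map s = (M + M'.map s).map s := by
    rw [Measure.map_add _ _ hs, Measure.map_map hs hs, hss.comp_self, Measure.map_id, add_comm]
  have dens : ∀ (ν : Measure Ω) (h G : Ω → ℝ), Measurable h → (∀ p, 0 ≤ h p) →
      ∫ p, G p ∂(ν.withDensity fun p => ENNReal.ofReal (h p)) = ∫ p, h p * G p ∂ν := by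
    intro ν h G hh hh0
    rw [integral_withDensity_eq_integral_toReal_smul hh.ennreal_ofReal (by simp)]
    simp [ENNReal.toReal_ofReal (hh0 _)]
  have hw : Measurable fun p => min (g p) (f (s p)) * F (s p) :=
    (hg.min (hf.comp hs)).mul (hF.comp hs)
  rw [hν] at hM'
  generalize M + M'.map s = ν at hM hM'
  rw [hM, hM', dens _ _ _ hf hf0, dens _ _ _ hg hg0]
  simp_rw [ha, hb, ← mul_assoc, accept _ _ (hf0 _) (hg0 _), accept _ _ (hg0 _) (hf0 _)]
  rw [integral_map hs.aemeasurable hw.aestronglyMeasurable]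
  simp_rw [hss _, min_comm]

lemma measurable_smul_map_prodMk (Q : Kernel X (X × U)) [IsMarkovKernel Q] {b : X → ℝ≥0∞}
    (hb : Measurable b) :
    Measurable fun x => b x • (Q x).map (fun yu => (x, yu)) := by
  refine Measure.measurable_of_measurable_coe _ fun t ht => ?_
  simp_rw [Measure.smul_apply, Measure.map_apply measurable_prodMk_left ht, smul_eq_mul]
  exact hb.mul (Kernel.measurable_kernel_prodMk_left ht)

/-- The transposition of the two state coordinates. -/
def swapStates (p : X × X × U) : X × X × U := (p.2.1, p.1, p.2.2)

lemma measurable_swapStates : Measurable (swapStates : X × X × U → X × X × U) := by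
  unfold swapStates
  fun_prop

lemma bind_smul_map_prodMk (π : Measure X) [SFinite π] (Q : Kernel X (X × U)) [IsMarkovKernel Q]
    {b : X → ℝ≥0∞} (hb : Measurable b) :
    π.bind (fun x => b x • (Q x).map (fun yu => (x, yu))) = π.withDensity b ⊗ₘ Q := by
  ext t ht
  rw [Measure.bind_apply ht (measurable_smul_map_prodMk Q hb).aemeasurable,
    Measure.compProd_apply ht,
    lintegral_withDensity_eq_lintegral_mul _ hb (Kernel.measurable_kernel_prodMk_left ht)]
  simp [Measure.map_apply measurable_prodMk_left ht]

lemma bind_smul_map_swapStates (π : Measure X) (Q : Kernel X (X × U)) [IsMarkovKernel Q]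
    {b : X → ℝ≥0∞} (hb : Measurable b) :
    π.bind (fun y => b y • (Q y).map (fun xu => (xu.1, y, xu.2)))
      = (π.bind (fun x => b x • (Q x).map (fun yu => (x, yu)))).map swapStates := by
  have hm := measurable_smul_map_prodMk Q hb
  have hfun : (fun y => b y • (Q y).map (fun xu => (xu.1, y, xu.2)))
      = fun y => (b y • (Q y).map (fun yu => (y, yu))).map swapStates := by
    funext y
    rw [Measure.map_smul, Measure.map_map measurable_swapStates measurable_prodMk_left]
    rfl
  ext t ht
  have hms := (Measure.measurable_map _ measurable_swapStates).comp hm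
  rw [hfun, Measure.bind_apply ht (f := fun y => (b y • (Q y).map (fun yu => (y, yu))).map
    swapStates) hms.aemeasurable, Measure.map_apply measurable_swapStates ht,
    Measure.bind_apply (measurable_swapStates ht) hm.aemeasurable]
  simp_rw [Measure.map_apply measurable_swapStates ht]

/-- Bounded integrands can be integrated iteratively against a weighted product. -/
lemma integral_mul_integral_eq_integral_compProd (π : Measure X) [IsFiniteMeasure π]
    (Q : Kernel X (X × U)) [IsMarkovKernel Q] {b : X → ℝ} (hb : Measurable b)
    (hb0 : ∀ x, 0 ≤ b x) (hb1 : ∀ x, b x ≤ 1) {G : X × X × U → ℝ} (hG : Measurable G) {C : ℝ}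
    (hGC : ∀ p, |G p| ≤ C) :
    ∫ x, b x * ∫ yu, G (x, yu) ∂(Q x) ∂π
      = ∫ p, G p ∂(π.withDensity (fun x => ENNReal.ofReal (b x)) ⊗ₘ Q) := by
  have : IsFiniteMeasure (π.withDensity (fun x => ENNReal.ofReal (b x))) := by
    refine isFiniteMeasure_withDensity_ofReal ?_
    exact HasFiniteIntegral.of_bounded (C := 1)
      (.of_forall fun x => by simpa [abs_of_nonneg (hb0 x)] using hb1 x)
  rw [Measure.integral_compProd (.of_bound hG.aestronglyMeasurable C (.of_forall hGC)),
    integral_withDensity_eq_integral_toReal_smul hb.ennreal_ofReal (by simp)]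
  simp [ENNReal.toReal_ofReal (hb0 _)]

lemma integrable_mul_integral (π : Measure X) [IsFiniteMeasure π]
    (Q : Kernel X (X × U)) [IsMarkovKernel Q] {b : X → ℝ} (hb : Measurable b)
    (hb0 : ∀ x, 0 ≤ b x) (hb1 : ∀ x, b x ≤ 1) {G : X × X × U → ℝ} (hG : Measurable G) {C : ℝ}
    (hGC : ∀ p, |G p| ≤ C) :
    Integrable (fun x => b x * ∫ yu, G (x, yu) ∂(Q x)) π := by
  have hI : Measurable fun x => ∫ yu, G (x, yu) ∂(Q x) :=
    (hG.stronglyMeasurable.integral_kernel_prod_right' (κ := Q)).measurable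
  refine .of_bound (hb.mul hI).aestronglyMeasurable C (.of_forall fun x => ?_)
  have h : ‖∫ yu, G (x, yu) ∂(Q x)‖ ≤ C := by
    simpa using norm_integral_le_of_norm_le_const (μ := Q x) (f := fun yu => G (x, yu))
      (.of_forall fun yu => hGC (x, yu))
  rw [norm_mul, Real.norm_of_nonneg (hb0 x)]
  exact (mul_le_of_le_one_left (norm_nonneg _) (hb1 x)).trans h

end

/-- **Detailed balance of the generalised MHAAR kernel with state-dependent mixture of
proposals (Corollary `cor: asymmetricMH generalisation` of Andrieu, Doucet, Yıldırım &
Chopin).**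

For a family of Markov kernels `Q i j : X → X × U` and measurable weights
`β i j : X → [0,1]` with `∑_{i,j} β i j x = 1`, let
`ν_{ij}(d(x,y,u)) = β_{ij}(x)π(dx)Q_{ij}(x,d(y,u)) + β_{ji}(y)π(dy)Q_{ji}(y,d(x,u))`,
`η_{ij}` a version of the density of the first summand w.r.t. `ν_{ij}`,
`r_{ij,u}(x,y) = η_{ji}(y,x,u)/η_{ij}(x,y,u)` where both are positive (else `0`), and
`ρ_{ij}` the rejection probabilities.  Then
`P̆(x,dy) = ∑_{i,j} β_{ij}(x)[∫_U Q_{ij}(x,d(y,u)) min{1, r_{ij,u}(x,y)} + ρ_{ij}(x)δ_x(dy)]`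
satisfies detailed balance with respect to `π`. -/
theorem mhaar_family_detailed_balance
    {X U : Type*} [MeasurableSpace X] [MeasurableSpace U]
    (m : ℕ)
    (π : Measure X) [IsProbabilityMeasure π]
    (Q : Fin m → Fin m → Kernel X (X × U)) [∀ i j, IsMarkovKernel (Q i j)]
    (β : Fin m → Fin m → X → ℝ)
    (hβm : ∀ i j, Measurable (β i j))
    (hβ0 : ∀ i j x, 0 ≤ β i j x) (hβ1 : ∀ i j x, β i j x ≤ 1)
    (hβsum : ∀ x, ∑ i, ∑ j, β i j x = 1)
    (η : Fin m → Fin m → X × X × U → ℝ)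
    (hηm : ∀ i j, Measurable (η i j)) (hη0 : ∀ i j p, 0 ≤ η i j p)
    -- `η i j` is a version of the density of `β_{ij}(x)π(dx)Q_{ij}(x,d(y,u))` w.r.t. `ν_{ij}`
    (hη : ∀ i j,
      π.bind (fun x => ENNReal.ofReal (β i j x) • ((Q i j x).map (fun yu => (x, yu))))
      = (π.bind (fun x =>
            ENNReal.ofReal (β i j x) • ((Q i j x).map (fun yu => (x, yu))))
          + π.bind (fun y =>
            ENNReal.ofReal (β j i y) •
              ((Q j i y).map (fun xu => (xu.1, y, xu.2))))).withDensity
          (fun p => ENNReal.ofReal (η i j p)))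
    (r : Fin m → Fin m → X × X × U → ℝ)
    (hr : ∀ i j (p : X × X × U), r i j p =
      if 0 < η i j p ∧ 0 < η j i (p.2.1, p.1, p.2.2)
        then η j i (p.2.1, p.1, p.2.2) / η i j p else 0)
    (ρ : Fin m → Fin m → X → ℝ)
    (hρ : ∀ i j x, ρ i j x = 1 - ∫ yu, min 1 (r i j (x, yu)) ∂(Q i j x))
    (φ : X → X → ℝ) (hφ : Measurable (Function.uncurry φ))
    (hφb : ∃ C, ∀ x y, |φ x y| ≤ C) :
    ∫ x, (∑ i, ∑ j, β i j x *
          ((∫ yu, min 1 (r i j (x, yu)) * φ x yu.1 ∂(Q i j x)) + ρ i j x * φ x x)) ∂π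
  = ∫ x, (∑ i, ∑ j, β i j x *
          ((∫ yu, min 1 (r i j (x, yu)) * φ yu.1 x ∂(Q i j x)) + ρ i j x * φ x x)) ∂π := by
  obtain ⟨C, hC⟩ := hφb
  have hr_meas : ∀ i j, Measurable (r i j) := by
    intro i j
    have hs : Measurable fun p : X × X × U => η j i (p.2.1, p.1, p.2.2) :=
      (hηm j i).comp measurable_swapStates
    rw [funext (hr i j)]
    exact Measurable.ite ((measurableSet_lt measurable_const (hηm i j)).inter
      (measurableSet_lt measurable_const hs)) (hs.div (hηm i j)) measurable_const
  have hr0 : ∀ i j p, 0 ≤ r i j p := by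
    intro i j p
    rw [hr]
    split_ifs with h
    exacts [div_nonneg h.2.le h.1.le, le_rfl]
  have hacc : ∀ i j p, |min 1 (r i j p)| ≤ 1 := fun i j p => by
    rw [abs_of_nonneg (le_min zero_le_one (hr0 i j p))]
    exact min_le_left _ _
  have hacc_meas : ∀ i j, Measurable fun p => min 1 (r i j p) :=
    fun i j => measurable_const.min (hr_meas i j)
  have hbound : ∀ i j p x y, |min 1 (r i j p) * φ x y| ≤ C := fun i j p x y => by
    rw [abs_mul]
    exact (mul_le_of_le_one_left (abs_nonneg _) (hacc i j p)).trans (hC x y)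
  have hφ₁ : Measurable fun p : X × X × U => φ p.1 p.2.1 :=
    hφ.comp (measurable_fst.prodMk measurable_snd.fst)
  have hφ₂ : Measurable fun p : X × X × U => φ p.2.1 p.1 :=
    hφ.comp (measurable_snd.fst.prodMk measurable_fst)
  have hrej : ∀ i j, Integrable (fun x => β i j x * (ρ i j x * φ x x)) π := by
    intro i j
    have hdiag : Measurable fun x => φ x x := hφ.comp (measurable_id.prodMk measurable_id)
    have h₁ : Integrable (fun x => β i j x * φ x x) π := by
      refine .of_bound ((hβm i j).mul hdiag).aestronglyMeasurable C (.of_forall fun x => ?_)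
      rw [norm_mul, Real.norm_of_nonneg (hβ0 i j x)]
      exact (mul_le_of_le_one_left (norm_nonneg _) (hβ1 i j x)).trans (hC x x)
    have h₂ := integrable_mul_integral π (Q i j) (hβm i j) (hβ0 i j) (hβ1 i j)
      ((hacc_meas i j).mul (hdiag.comp measurable_fst)) (fun p => hbound i j p p.1 p.1)
    refine (h₁.sub h₂).congr (.of_forall fun x => ?_)
    simp only [hρ, Pi.sub_apply, Function.comp_apply, Pi.mul_apply]
    rw [integral_mul_const]
    ring
  have hprop₁ := fun i j => integrable_mul_integral π (Q i j) (hβm i j) (hβ0 i j) (hβ1 i j)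
    ((hacc_meas i j).mul hφ₁) (fun p => hbound i j p _ _)
  have hprop₂ := fun i j => integrable_mul_integral π (Q i j) (hβm i j) (hβ0 i j) (hβ1 i j)
    ((hacc_meas i j).mul hφ₂) (fun p => hbound i j p _ _)
  have key : ∀ i j,
      ∫ x, β i j x * ∫ yu, min 1 (r i j (x, yu)) * φ x yu.1 ∂(Q i j x) ∂π
        = ∫ x, β j i x * ∫ yu, min 1 (r j i (x, yu)) * φ yu.1 x ∂(Q j i x) ∂π := by
    intro i j
    have hη' := hη
    simp_rw [fun i j => bind_smul_map_swapStates π (Q i j) (hβm i j).ennreal_ofReal,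
      fun i j => bind_smul_map_prodMk π (Q i j) (hβm i j).ennreal_ofReal] at hη'
    have h₁ := integral_mul_integral_eq_integral_compProd π (Q i j) (hβm i j) (hβ0 i j) (hβ1 i j)
      ((hacc_meas i j).mul hφ₁) (fun p => hbound i j p _ _)
    have h₂ := integral_mul_integral_eq_integral_compProd π (Q j i) (hβm j i) (hβ0 j i) (hβ1 j i)
      ((hacc_meas j i).mul hφ₂) (fun p => hbound j i p _ _)
    refine h₁.trans (Eq.trans ?_ h₂.symm)
    exact integral_accept_eq_integral_accept_comp_involution measurable_swapStates (fun _ => rfl)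
      (hηm i j) (hηm j i) (hη0 i j) (hη0 j i) (hη' i j) (hη' j i) (hr i j) (hr j i) hφ₁
  have expand : ∀ A B : Fin m → Fin m → X → ℝ, (∀ i j, Integrable (A i j) π) →
      (∀ i j, Integrable (B i j) π) → ∫ x, ∑ i, ∑ j, (A i j x + B i j x) ∂π
        = ∑ i, ∑ j, ∫ x, A i j x ∂π + ∑ i, ∑ j, ∫ x, B i j x ∂π := by
    intro A B hA hB
    refine (integral_finsetSum _ fun i _ =>
      integrable_finsetSum _ fun j _ => (hA i j).add (hB i j)).trans ?_
    rw [← Finset.sum_add_distrib]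
    refine Finset.sum_congr rfl fun i _ => ?_
    rw [← Finset.sum_add_distrib]
    refine (integral_finsetSum _ fun j _ => (hA i j).add (hB i j)).trans ?_
    exact Finset.sum_congr rfl fun j _ => integral_add (hA i j) (hB i j)
  simp_rw [mul_add]
  refine (expand _ _ hprop₁ hrej).trans (Eq.trans ?_ (expand _ _ hprop₂ hrej).symm)
  congr 1
  rw [Finset.sum_comm]
  exact Finset.sum_congr rfl fun j _ => Finset.sum_congr rfl fun i _ => key i j
end
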